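/- For every β ≥ 0, lim_{d→∞} limsup_{n→∞} (1/n) | E_g[⟨H_SK(σ)⟩_{β,g}] − (1/√d) E_A[⟨H_d(σ)⟩_{β/√d,A}] | = 0, where the inner Gibbs averages are over one sample from μ_{β,g} and μ_{β/√d,A} respectively, and the outer expectations are over the SK disorder g and the sparse disorder A. -/

import Mathlib

open MeasureTheory ProbabilityTheory Filter

noncomputable section

/-- The value of a ±1 spin encoded as a Boolean. -/
def spin (b : Bool) : ℝ := if b then 1 else -1

/-- The Ising Hamiltonian `H(σ; X) = ∑_{i,j} X i j σ(i) σ(j)`. -/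
def Ham {n : ℕ} (X : Fin n → Fin n → ℝ) (σ : Fin n → Bool) : ℝ :=
  ∑ i, ∑ j, X i j * spin (σ i) * spin (σ j)

/-- The partition function `Z(β, X)`. -/
def Zpart {n : ℕ} (β : ℝ) (X : Fin n → Fin n → ℝ) : ℝ :=
  ∑ σ : Fin n → Bool, Real.exp (-β * Ham X σ)

/-- The Gibbs probability mass function `μ_{β,X}(σ)`. -/
def gibbs {n : ℕ} (β : ℝ) (X : Fin n → Fin n → ℝ) (σ : Fin n → Bool) : ℝ :=
  Real.exp (-β * Ham X σ) / Zpart β X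

/-- A configuration is a bisection if `|∑ i σ(i)| ≤ 1`. -/
def isBis {n : ℕ} (σ : Fin n → Bool) : Prop := |∑ i, spin (σ i)| ≤ 1

open scoped Classical in
/-- The bisection partition function `Z^bis(β, X)`. -/
def ZpartBis {n : ℕ} (β : ℝ) (X : Fin n → Fin n → ℝ) : ℝ :=
  ∑ σ : Fin n → Bool, if isBis σ then Real.exp (-β * Ham X σ) else 0

open scoped Classical in
/-- The bisection Gibbs probability mass function `μ^bis_{β,X}(σ)`. -/
def gibbsBis {n : ℕ} (β : ℝ) (X : Fin n → Fin n → ℝ) (σ : Fin n → Bool) : ℝ :=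
  if isBis σ then Real.exp (-β * Ham X σ) / ZpartBis β X else 0

/-- The overlap `R_{1,2}(σ1, σ2) = (1/n) ∑ i σ1(i) σ2(i)`. -/
def overlap {n : ℕ} (σ1 σ2 : Fin n → Bool) : ℝ :=
  (1 / (n : ℝ)) * ∑ i, spin (σ1 i) * spin (σ2 i)

/-- Gibbs average of a one-variable observable. -/
def avg1 {n : ℕ} (β : ℝ) (X : Fin n → Fin n → ℝ) (f : (Fin n → Bool) → ℝ) : ℝ :=
  ∑ σ : Fin n → Bool, f σ * gibbs β X σ

/-- Bisection Gibbs average of a one-variable observable. -/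
def avg1Bis {n : ℕ} (β : ℝ) (X : Fin n → Fin n → ℝ) (f : (Fin n → Bool) → ℝ) : ℝ :=
  ∑ σ : Fin n → Bool, f σ * gibbsBis β X σ

/-- Coupled Gibbs average: `σ1 ~ μ_{β,X}`, `σ2 ~ μ_{β,Y}` independent. -/
def avg2c {n : ℕ} (β : ℝ) (X Y : Fin n → Fin n → ℝ)
    (f : (Fin n → Bool) → (Fin n → Bool) → ℝ) : ℝ :=
  ∑ σ1 : Fin n → Bool, ∑ σ2 : Fin n → Bool, f σ1 σ2 * gibbs β X σ1 * gibbs β Y σ2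

/-- Gibbs average of a two-replica observable. -/
def avg2 {n : ℕ} (β : ℝ) (X : Fin n → Fin n → ℝ)
    (f : (Fin n → Bool) → (Fin n → Bool) → ℝ) : ℝ :=
  avg2c β X X f

/-- Coupled bisection Gibbs average. -/
def avg2cBis {n : ℕ} (β : ℝ) (X Y : Fin n → Fin n → ℝ)
    (f : (Fin n → Bool) → (Fin n → Bool) → ℝ) : ℝ :=
  ∑ σ1 : Fin n → Bool, ∑ σ2 : Fin n → Bool, f σ1 σ2 * gibbsBis β X σ1 * gibbsBis β Y σ2

/-- Bisection Gibbs average of a two-replica observable. -/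
def avg2Bis {n : ℕ} (β : ℝ) (X : Fin n → Fin n → ℝ)
    (f : (Fin n → Bool) → (Fin n → Bool) → ℝ) : ℝ :=
  avg2cBis β X X f

/-- The SK disorder: i.i.d. entries `N(0, 1/(2n))`. -/
def skMeasure (n : ℕ) : Measure (Fin n → Fin n → ℝ) :=
  Measure.pi fun _ => Measure.pi fun _ => gaussianReal 0 (1 / (2 * n))

/-- The law of the pair `(g, g')` of independent SK disorders. -/
def skPair (n : ℕ) : Measure ((Fin n → Fin n → ℝ) × (Fin n → Fin n → ℝ)) :=
  (skMeasure n).prod (skMeasure n)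

/-- The perturbed SK disorder `g_t = √(1-t) g + √t g'`. -/
def skPerturb {n : ℕ} (t : ℝ) (g g' : Fin n → Fin n → ℝ) : Fin n → Fin n → ℝ :=
  fun i j => Real.sqrt (1 - t) * g i j + Real.sqrt t * g' i j

/-- The sparse disorder: i.i.d. entries `Poisson(d/(2n))`. -/
def sparseMeasure (n : ℕ) (d : ℝ) : Measure (Fin n → Fin n → ℕ) :=
  Measure.pi fun _ => Measure.pi fun _ => poissonMeasure (d / (2 * n)).toNNReal

/-- The law of the triple `(A^{(1-t)}, A^{(t,1)}, A^{(t,2)})` of independent sparse disorders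
used to build the coupled pair `A = A^{(1-t)} + A^{(t,1)}`, `A_t = A^{(1-t)} + A^{(t,2)}`. -/
def coupledSparse (n : ℕ) (d t : ℝ) :
    Measure ((Fin n → Fin n → ℕ) × (Fin n → Fin n → ℕ) × (Fin n → Fin n → ℕ)) :=
  (sparseMeasure n ((1 - t) * d)).prod
    ((sparseMeasure n (t * d)).prod (sparseMeasure n (t * d)))

/-- View an ℕ-valued matrix as a real matrix. -/
def natMat {n : ℕ} (A : Fin n → Fin n → ℕ) : Fin n → Fin n → ℝ := fun i j => (A i j : ℝ)

/-- The Gibbs measure `μ_{β,X}` as a probability measure on configurations. -/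
def gibbsMeasure {n : ℕ} (β : ℝ) (X : Fin n → Fin n → ℝ) : Measure (Fin n → Bool) :=
  ∑ σ : Fin n → Bool, ENNReal.ofReal (gibbs β X σ) • Measure.dirac σ

/-- The bisection Gibbs measure `μ^bis_{β,X}` as a measure on configurations. -/
def gibbsBisMeasure {n : ℕ} (β : ℝ) (X : Fin n → Fin n → ℝ) : Measure (Fin n → Bool) :=
  ∑ σ : Fin n → Bool, ENNReal.ofReal (gibbsBis β X σ) • Measure.dirac σ

/-- Normalized Wasserstein distance `W_{2,n}` between measures on `{-1,1}^n`. -/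
def W2 (n : ℕ) (μ1 μ2 : Measure (Fin n → Bool)) : ℝ :=
  sInf {r : ℝ | ∃ π : Measure ((Fin n → Bool) × (Fin n → Bool)),
    IsProbabilityMeasure π ∧ π.map Prod.fst = μ1 ∧ π.map Prod.snd = μ2 ∧
    r = Real.sqrt (∫ p, (1 / (n : ℝ)) * ∑ i, (spin (p.1 i) - spin (p.2 i)) ^ 2 ∂π)}

open scoped Classical in
/-- Overlap-restricted coupled partition function `Z^S_{X,Y}`. -/
def Zres {n : ℕ} (β : ℝ) (S : Set ℝ) (X Y : Fin n → Fin n → ℝ) : ℝ :=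
  ∑ σ1 : Fin n → Bool, ∑ σ2 : Fin n → Bool,
    if overlap σ1 σ2 ∈ S then Real.exp (-β * (Ham X σ1 + Ham Y σ2)) else 0

open scoped Classical in
/-- Overlap-restricted coupled bisection partition function `Z^{S,bis}_{X,Y}`. -/
def ZresBis {n : ℕ} (β : ℝ) (S : Set ℝ) (X Y : Fin n → Fin n → ℝ) : ℝ :=
  ∑ σ1 : Fin n → Bool, ∑ σ2 : Fin n → Bool,
    if isBis σ1 ∧ isBis σ2 ∧ overlap σ1 σ2 ∈ S
    then Real.exp (-β * (Ham X σ1 + Ham Y σ2)) else 0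

/-- The matrix with a single `1` in position `(i,j)`. -/
def Jmat {n : ℕ} (i j : Fin n) : Fin n → Fin n → ℝ :=
  fun a b => if a = i ∧ b = j then 1 else 0

end

/-- The log-sum-exp function. -/
noncomputable def lse {ι : Type*} [Fintype ι] (w : ι → ℝ) : ℝ := Real.log (∑ a, Real.exp (w a))

/-- The softmax weights, i.e. the Gibbs weights with energies `-w`. -/
noncomputable def softmax {ι : Type*} [Fintype ι] (w : ι → ℝ) (a : ι) : ℝ :=
  Real.exp (w a) / ∑ b, Real.exp (w b)

section LogSumExp

variable {ι : Type*} [Fintype ι]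

lemma softmax_nonneg (w : ι → ℝ) (a : ι) : 0 ≤ softmax w a :=
  div_nonneg (Real.exp_pos _).le (Finset.sum_nonneg fun _ _ => (Real.exp_pos _).le)

/-- The `k`-th moment sums along the line `w + r x`. -/
private noncomputable def momSum (w x : ι → ℝ) (k : ℕ) (r : ℝ) : ℝ :=
  ∑ a, x a ^ k * Real.exp (w a + r * x a)

private lemma hasDerivAt_momSum (w x : ι → ℝ) (k : ℕ) (r : ℝ) :
    HasDerivAt (momSum w x k) (momSum w x (k + 1) r) r := by
  unfold momSum
  refine HasDerivAt.fun_sum fun a _ => ?_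
  have h := ((((hasDerivAt_id r).mul_const (x a)).const_add (w a)).exp).const_mul (x a ^ k)
  refine h.congr_deriv ?_
  simp only [id]; ring

variable [Nonempty ι]

lemma sum_exp_pos (w : ι → ℝ) : 0 < ∑ a, Real.exp (w a) :=
  Finset.sum_pos (fun _ _ => Real.exp_pos _) Finset.univ_nonempty

lemma sum_softmax (w : ι → ℝ) : ∑ a, softmax w a = 1 := by
  unfold softmax
  rw [← Finset.sum_div, div_self (sum_exp_pos w).ne']

lemma continuous_lse : Continuous (lse : (ι → ℝ) → ℝ) := by
  unfold lse
  exact Continuous.log (by fun_prop) fun w => (sum_exp_pos w).ne'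

lemma measurable_lse : Measurable (lse : (ι → ℝ) → ℝ) := continuous_lse.measurable

/-- The subgradient inequality for the convex function `lse`. -/
lemma lse_add_ge (w x : ι → ℝ) : lse w + ∑ a, softmax w a * x a ≤ lse (w + x) := by
  have h := convexOn_exp.map_sum_le (t := Finset.univ) (w := softmax w) (p := x)
    (fun a _ => softmax_nonneg w a) (sum_softmax w) (fun _ _ => Set.mem_univ _)
  simp only [smul_eq_mul] at h
  have hs := sum_exp_pos w
  have h2 : ∑ a, softmax w a * Real.exp (x a)
      = (∑ a, Real.exp ((w + x) a)) / ∑ a, Real.exp (w a) := by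
    rw [Finset.sum_div]
    refine Finset.sum_congr rfl fun a _ => ?_
    rw [softmax, Pi.add_apply, Real.exp_add]; ring
  rw [h2, le_div_iff₀ hs] at h
  unfold lse
  rw [Real.le_log_iff_exp_le (sum_exp_pos _), Real.exp_add, Real.exp_log hs]
  linarith

lemma abs_sum_softmax_mul_le (w x : ι → ℝ) {M : ℝ} (hx : ∀ a, |x a| ≤ M) :
    |∑ a, softmax w a * x a| ≤ M := by
  calc |∑ a, softmax w a * x a| ≤ ∑ a, |softmax w a * x a| := Finset.abs_sum_le_sum_abs _ _
    _ ≤ ∑ a, softmax w a * M := by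
        refine Finset.sum_le_sum fun a _ => ?_
        rw [abs_mul, abs_of_nonneg (softmax_nonneg w a)]
        exact mul_le_mul_of_nonneg_left (hx a) (softmax_nonneg w a)
    _ = M := by rw [← Finset.sum_mul, sum_softmax, one_mul]

lemma abs_lse_add_sub_le (w x : ι → ℝ) {M : ℝ} (hx : ∀ a, |x a| ≤ M) :
    |lse (w + x) - lse w| ≤ M := by
  have h1 := lse_add_ge w x
  have h2 := lse_add_ge (w + x) (-x)
  have h3 := abs_le.1 (abs_sum_softmax_mul_le w x hx)
  have h4 := abs_le.1 (abs_sum_softmax_mul_le (w + x) (-x) (M := M) (by simpa using hx))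
  rw [add_neg_cancel_right] at h2
  rw [abs_le]; constructor <;> linarith

private lemma momSum_zero_pos (w x : ι → ℝ) (r : ℝ) : 0 < momSum w x 0 r := by
  unfold momSum
  simpa using sum_exp_pos fun a => w a + r * x a

private lemma abs_momSum_div_le (w x : ι → ℝ) {M : ℝ} (hx : ∀ a, |x a| ≤ M) (k : ℕ) (r : ℝ) :
    |momSum w x k r / momSum w x 0 r| ≤ M ^ k := by
  have hp := momSum_zero_pos w x r
  rw [abs_div, abs_of_pos hp, div_le_iff₀ hp]
  unfold momSum
  rw [Finset.mul_sum]
  refine (Finset.abs_sum_le_sum_abs _ _).trans (Finset.sum_le_sum fun a _ => ?_)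
  rw [abs_mul, abs_of_pos (Real.exp_pos _), abs_pow, pow_zero, one_mul]
  exact mul_le_mul_of_nonneg_right (pow_le_pow_left₀ (abs_nonneg _) (hx a) k) (Real.exp_pos _).le

private lemma abs_sub_le_of_deriv_bound {f f' : ℝ → ℝ} {K : ℝ}
    (hf : ∀ r, HasDerivAt f (f' r) r) (hb : ∀ r ∈ Set.Icc (0 : ℝ) 1, |f' r| ≤ K) :
    ∀ r ∈ Set.Icc (0 : ℝ) 1, |f r - f 0| ≤ K := by
  intro r hr
  have h := (convex_Icc (0 : ℝ) 1).norm_image_sub_le_of_norm_hasDerivWithin_le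
    (fun s _ => (hf s).hasDerivWithinAt) (fun s hs => hb s hs)
    (Set.left_mem_Icc.2 zero_le_one) hr
  have hK : 0 ≤ K := (abs_nonneg _).trans (hb r hr)
  simp only [Real.norm_eq_abs, sub_zero] at h
  refine h.trans ?_
  rw [abs_of_nonneg hr.1]
  exact mul_le_of_le_one_right hK hr.2

/-- Second order Taylor expansion of `lse` with a cubic remainder. -/
lemma abs_lse_taylor_le (w x : ι → ℝ) {M : ℝ} (hx : ∀ a, |x a| ≤ M) :
    |lse (w + x) - lse w - ∑ a, softmax w a * x a
      - (∑ a, softmax w a * x a ^ 2 - (∑ a, softmax w a * x a) ^ 2) / 2| ≤ 6 * M ^ 3 := by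
  set q : ℕ → ℝ → ℝ := fun k r => momSum w x k r / momSum w x 0 r with hq
  have hq0 : ∀ r, q 0 r = 1 := fun r => div_self (momSum_zero_pos w x r).ne'
  have hqd : ∀ k r, HasDerivAt (q k) (q (k + 1) r - q k r * q 1 r) r := by
    intro k r
    have h := (hasDerivAt_momSum w x k r).div (hasDerivAt_momSum w x 0 r)
      (momSum_zero_pos w x r).ne'
    refine h.congr_deriv ?_
    have := (momSum_zero_pos w x r).ne'
    simp only [hq]; field_simp
  have hqb : ∀ k r, |q k r| ≤ M ^ k := fun k r => abs_momSum_div_le w x hx k r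
  have hM : 0 ≤ M := by
    obtain ⟨a⟩ := ‹Nonempty ι›
    exact (abs_nonneg _).trans (hx a)
  have hqs : ∀ k, q k 0 = ∑ a, softmax w a * x a ^ k := by
    intro k
    simp only [hq, momSum, softmax, zero_mul, add_zero, pow_zero, one_mul]
    rw [Finset.sum_div]
    exact Finset.sum_congr rfl fun a _ => by ring
  have hlog : ∀ r, HasDerivAt (fun r => Real.log (momSum w x 0 r)) (q 1 r) r := fun r =>
    (hasDerivAt_momSum w x 0 r).log (momSum_zero_pos w x r).ne'
  have hvar : ∀ r, HasDerivAt (fun r => q 2 r - q 1 r ^ 2)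
      (q 3 r - q 2 r * q 1 r - 2 * q 1 r * (q 2 r - q 1 r * q 1 r)) r := by
    intro r
    have h := (hqd 2 r).sub ((hqd 1 r).pow 2)
    refine h.congr_deriv ?_
    norm_num
  have hb3 : ∀ r, |q 3 r - q 2 r * q 1 r - 2 * q 1 r * (q 2 r - q 1 r * q 1 r)| ≤ 6 * M ^ 3 := by
    intro r
    have h1 := hqb 1 r
    have h2 := hqb 2 r
    have h3 := hqb 3 r
    have h21 : |q 2 r * q 1 r| ≤ M ^ 3 := by
      rw [abs_mul]
      calc _ ≤ M ^ 2 * M ^ 1 := mul_le_mul h2 h1 (abs_nonneg _) (by positivity)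
        _ = M ^ 3 := by ring
    have h111 : |q 1 r ^ 3| ≤ M ^ 3 := by
      rw [abs_pow]
      exact pow_le_pow_left₀ (abs_nonneg _) (by simpa using h1) 3
    rw [abs_le] at *
    constructor <;> nlinarith
  have s2 := abs_sub_le_of_deriv_bound hvar fun r _ => hb3 r
  have s1 := abs_sub_le_of_deriv_bound
    (f := fun r => q 1 r - r * (q 2 0 - q 1 0 ^ 2))
    (f' := fun r => (q 2 r - q 1 r ^ 2) - (q 2 0 - q 1 0 ^ 2)) (fun r => by
      have h := (hqd 1 r).sub ((hasDerivAt_id r).mul_const (q 2 0 - q 1 0 ^ 2))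
      refine h.congr_deriv ?_
      norm_num
      ring) s2
  have s0 := abs_sub_le_of_deriv_bound
    (f := fun r => Real.log (momSum w x 0 r) - r * q 1 0 - r ^ 2 / 2 * (q 2 0 - q 1 0 ^ 2))
    (f' := fun r => q 1 r - r * (q 2 0 - q 1 0 ^ 2) - (q 1 0 - 0 * (q 2 0 - q 1 0 ^ 2)))
    (fun r => by
      have h := ((hlog r).sub ((hasDerivAt_id r).mul_const (q 1 0))).sub
        ((((hasDerivAt_id r).pow 2).div_const 2).mul_const (q 2 0 - q 1 0 ^ 2))
      refine h.congr_deriv ?_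
      norm_num
      ring) s1 1 (Set.right_mem_Icc.2 zero_le_one)
  simp only [hqs] at s0
  have e1 : Real.log (momSum w x 0 1) = lse (w + x) := by simp [momSum, lse]
  have e0 : Real.log (momSum w x 0 0) = lse w := by simp [momSum, lse]
  rw [e1, e0] at s0
  simp only [pow_one] at s0
  convert s0 using 2
  ring

end LogSumExp

section GaussianComparison

variable {ι : Type*} [Fintype ι] [Nonempty ι]

section Expansion

variable {Ω : Type*} [MeasurableSpace Ω] {P : Measure Ω} [IsProbabilityMeasure P]

lemma integrable_of_abs_le_of_cube {f N : Ω → ℝ} (hf : Measurable f)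
    (hN : Integrable (fun ω => N ω ^ 3) P) (k : ℕ) (hk : k ≤ 3) (h : ∀ ω, |f ω| ≤ N ω ^ k)
    (hN0 : ∀ ω, 0 ≤ N ω) : Integrable f P := by
  refine ((integrable_const (1 : ℝ)).add hN).mono' hf.aestronglyMeasurable (ae_of_all _ fun ω => ?_)
  refine (h ω).trans ?_
  simp only [Pi.add_apply]
  rcases le_total (N ω) 1 with h1 | h1
  · have := pow_le_one₀ (n := k) (hN0 ω) h1
    have := pow_nonneg (hN0 ω) 3
    linarith
  · have := pow_le_pow_right₀ h1 hk
    linarith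

lemma integrable_lse_add {X : Ω → ι → ℝ} {N : Ω → ℝ} (hX : Measurable X) (hN : Integrable N P)
    (hb : ∀ ω a, |X ω a| ≤ N ω) (w : ι → ℝ) : Integrable (fun ω => lse (w + X ω)) P := by
  refine ((integrable_const |lse w|).add hN).mono'
    (measurable_lse.comp (by fun_prop)).aestronglyMeasurable (ae_of_all _ fun ω => ?_)
  have h := abs_lse_add_sub_le w (X ω) (hb ω)
  have h2 := abs_sub_abs_le_abs_sub (lse (w + X ω)) (lse w)
  simp only [Pi.add_apply, Real.norm_eq_abs]
  linarith

/-- Expansion of the averaged `lse` to second order under a small random perturbation. -/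
lemma abs_integral_lse_expansion_le {X : Ω → ι → ℝ} {N : Ω → ℝ} (hX : Measurable X)
    (hNm : Measurable N) (hN : Integrable (fun ω => N ω ^ 3) P)
    (hb : ∀ ω a, |X ω a| ≤ N ω) (w : ι → ℝ) :
    |∫ ω, lse (w + X ω) ∂P - lse w - ∑ a, softmax w a * ∫ ω, X ω a ∂P
      - (∑ a, softmax w a * ∫ ω, X ω a * X ω a ∂P
        - ∑ a, ∑ b, softmax w a * softmax w b * ∫ ω, X ω a * X ω b ∂P) / 2|
      ≤ 6 * ∫ ω, N ω ^ 3 ∂P := by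
  have hN0 : ∀ ω, 0 ≤ N ω := fun ω => (abs_nonneg _).trans (hb ω (Classical.arbitrary ι))
  have hXa : ∀ a, Measurable fun ω => X ω a := fun a => by fun_prop
  have hNi : Integrable N P := integrable_of_abs_le_of_cube hNm hN 1 (by norm_num)
    (fun ω => by rw [abs_of_nonneg (hN0 ω), pow_one]) hN0
  have i1 : ∀ a, Integrable (fun ω => X ω a) P := fun a =>
    integrable_of_abs_le_of_cube (hXa a) hN 1 (by norm_num) (fun ω => by simpa using hb ω a) hN0
  have i2 : ∀ a b, Integrable (fun ω => X ω a * X ω b) P := fun a b =>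
    integrable_of_abs_le_of_cube ((hXa a).mul (hXa b)) hN 2 (by norm_num) (fun ω => by
      rw [abs_mul, sq]
      exact mul_le_mul (hb ω a) (hb ω b) (abs_nonneg _) (hN0 ω)) hN0
  have i0 := integrable_lse_add hX hNi hb w
  have j1 : Integrable (fun ω => ∑ a, softmax w a * X ω a) P :=
    integrable_finsetSum _ fun a _ => (i1 a).const_mul _
  have j2 : Integrable (fun ω => ∑ a, softmax w a * (X ω a * X ω a)) P :=
    integrable_finsetSum _ fun a _ => (i2 a a).const_mul _
  have j3 : Integrable (fun ω => ∑ a, ∑ b, softmax w a * softmax w b * (X ω a * X ω b)) P :=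
    integrable_finsetSum _ fun a _ => integrable_finsetSum _ fun b _ => (i2 a b).const_mul _
  have key : ∫ ω, (lse (w + X ω) - lse w - ∑ a, softmax w a * X ω a
      - (∑ a, softmax w a * (X ω a * X ω a)
        - ∑ a, ∑ b, softmax w a * softmax w b * (X ω a * X ω b)) / 2) ∂P
      = ∫ ω, lse (w + X ω) ∂P - lse w - ∑ a, softmax w a * ∫ ω, X ω a ∂P
      - (∑ a, softmax w a * ∫ ω, X ω a * X ω a ∂P
        - ∑ a, ∑ b, softmax w a * softmax w b * ∫ ω, X ω a * X ω b ∂P) / 2 := by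
    have k0 : Integrable (fun ω => lse (w + X ω) - lse w) P := i0.sub (integrable_const _)
    have k1 : Integrable (fun ω => lse (w + X ω) - lse w - ∑ a, softmax w a * X ω a) P :=
      k0.sub j1
    have k2 : Integrable (fun ω => (∑ a, softmax w a * (X ω a * X ω a)
        - ∑ a, ∑ b, softmax w a * softmax w b * (X ω a * X ω b)) / 2) P :=
      (j2.sub j3).div_const 2
    rw [integral_sub k1 k2, integral_sub k0 j1, integral_sub i0 (integrable_const _),
      integral_div, integral_sub j2 j3, integral_finsetSum _ fun a _ => (i1 a).const_mul _,
      integral_finsetSum _ fun a _ => (i2 a a).const_mul _,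
      integral_finsetSum _ fun a _ => integrable_finsetSum _ fun b _ => (i2 a b).const_mul _]
    simp_rw [integral_const_mul]
    congr 2
    · simp
    · congr 1
      refine Finset.sum_congr rfl fun a _ => ?_
      rw [integral_finsetSum _ fun b _ => (i2 a b).const_mul _]
      simp_rw [integral_const_mul]
  rw [← key, ← integral_const_mul, ← Real.norm_eq_abs]
  refine norm_integral_le_of_norm_le (hN.const_mul 6) (ae_of_all _ fun ω => ?_)
  have h := abs_lse_taylor_le w (X ω) (hb ω)
  rw [Real.norm_eq_abs]
  convert h using 4
  congr 1
  · exact Finset.sum_congr rfl fun a _ => by ring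
  · rw [sq, Finset.sum_mul_sum]
    exact Finset.sum_congr rfl fun a _ => Finset.sum_congr rfl fun b _ => by ring

end Expansion

/-- `γ` is the law of a centered Gaussian vector with covariance `C`, recorded through the
invariance of `γ` under normalized sums and its moments up to order three. -/
structure IsGaussField (γ : Measure (ι → ℝ)) (C : ι → ι → ℝ) : Prop where
  prob : IsProbabilityMeasure γ
  stable : (γ.prod γ).map (fun p => (√2)⁻¹ • (p.1 + p.2)) = γ
  cube : Integrable (fun x => ‖x‖ ^ 3) γ
  mean : ∀ a, ∫ x, x a ∂γ = 0
  cov : ∀ a b, ∫ x, x a * x b ∂γ = C a b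

namespace IsGaussField

variable {γ γ' : Measure (ι → ℝ)} {C C' : ι → ι → ℝ}

lemma integrable_norm (h : IsGaussField γ C) : Integrable (fun x => ‖x‖) γ := by
  have := h.prob
  exact integrable_of_abs_le_of_cube (by fun_prop) h.cube 1 (by norm_num) (fun x => by simp)
    fun x => norm_nonneg x

lemma integrable_lse_smul (h : IsGaussField γ C) (w : ι → ℝ) (ε : ℝ) :
    Integrable (fun x => lse (w + ε • x)) γ := by
  have := h.prob
  refine integrable_lse_add (by fun_prop) (h.integrable_norm.const_mul |ε|) (fun x a => ?_) w
  simp only [Pi.smul_apply, smul_eq_mul, abs_mul]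
  exact mul_le_mul_of_nonneg_left (norm_le_pi_norm x a) (abs_nonneg _)

lemma integrable_lse_prod (h : IsGaussField γ C) (h' : IsGaussField γ' C') (w : ι → ℝ) (ε : ℝ) :
    Integrable (fun p : (ι → ℝ) × (ι → ℝ) => lse (w + ε • p.1 + ε • p.2)) (γ.prod γ') := by
  have := h.prob
  have := h'.prob
  have h1 : Integrable (fun p : (ι → ℝ) × (ι → ℝ) => |ε| * ‖p.1‖ + |ε| * ‖p.2‖) (γ.prod γ') :=
    ((h.integrable_norm.comp_fst γ').const_mul |ε|).add
      ((h'.integrable_norm.comp_snd γ).const_mul |ε|)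
  simp_rw [add_assoc]
  refine integrable_lse_add (by fun_prop) h1 (fun x a => ?_) w
  simp only [Pi.smul_apply, smul_eq_mul, Pi.add_apply]
  refine (abs_add_le _ _).trans (add_le_add ?_ ?_) <;> rw [abs_mul]
  · exact mul_le_mul_of_nonneg_left (norm_le_pi_norm x.1 a) (abs_nonneg _)
  · exact mul_le_mul_of_nonneg_left (norm_le_pi_norm x.2 a) (abs_nonneg _)

lemma integral_lse_sqrt_two (h : IsGaussField γ C) (w : ι → ℝ) (ε : ℝ) :
    ∫ x, lse (w + (√2 * ε) • x) ∂γ = ∫ p, lse (w + ε • p.1 + ε • p.2) ∂(γ.prod γ) := by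
  conv_lhs => rw [← h.stable]
  have hm : Measurable fun x : ι → ℝ => lse (w + (√2 * ε) • x) := measurable_lse.comp (by fun_prop)
  rw [integral_map (by fun_prop) hm.aestronglyMeasurable]
  refine integral_congr_ae (ae_of_all _ fun p => ?_)
  have : √2 * ε * (√2)⁻¹ = ε := by
    have : √2 ≠ 0 := by positivity
    field_simp
  simp only [smul_smul, this, smul_add, add_assoc]

lemma lse_doubling (h : IsGaussField γ C) (h' : IsGaussField γ' C') {ε η : ℝ}
    (hε : ∀ w, ∫ x, lse (w + ε • x) ∂γ' - η ≤ ∫ x, lse (w + ε • x) ∂γ) (w : ι → ℝ) :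
    ∫ x, lse (w + (√2 * ε) • x) ∂γ' - 2 * η ≤ ∫ x, lse (w + (√2 * ε) • x) ∂γ := by
  have := h.prob
  have := h'.prob
  rw [h.integral_lse_sqrt_two, h'.integral_lse_sqrt_two]
  have e1 := integral_prod _ (h.integrable_lse_prod h w ε)
  have e2 := integral_prod _ (h.integrable_lse_prod h' w ε)
  have e3 := integral_prod _ (h'.integrable_lse_prod h w ε)
  have e4 := integral_prod _ (h'.integrable_lse_prod h' w ε)
  have sw : ∫ p, lse (w + ε • p.1 + ε • p.2) ∂(γ.prod γ')
      = ∫ p, lse (w + ε • p.1 + ε • p.2) ∂(γ'.prod γ) := by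
    rw [← integral_prod_swap]
    refine integral_congr_ae (ae_of_all _ fun p => ?_)
    simp only [Prod.fst_swap, Prod.snd_swap]
    congr 1
    abel
  have m1 : ∫ p, lse (w + ε • p.1 + ε • p.2) ∂(γ.prod γ') - η
      ≤ ∫ p, lse (w + ε • p.1 + ε • p.2) ∂(γ.prod γ) := by
    rw [e1, e2]
    have : ∫ x, ((∫ y, lse (w + ε • x + ε • y) ∂γ') - η) ∂γ
        ≤ ∫ x, (∫ y, lse (w + ε • x + ε • y) ∂γ) ∂γ :=
      integral_mono ((h.integrable_lse_prod h' w ε).integral_prod_left.sub (integrable_const _))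
        (h.integrable_lse_prod h w ε).integral_prod_left fun x => hε _
    rw [integral_sub (h.integrable_lse_prod h' w ε).integral_prod_left (integrable_const _)] at this
    simpa using this
  have m2 : ∫ p, lse (w + ε • p.1 + ε • p.2) ∂(γ'.prod γ') - η
      ≤ ∫ p, lse (w + ε • p.1 + ε • p.2) ∂(γ'.prod γ) := by
    rw [e3, e4]
    have : ∫ x, ((∫ y, lse (w + ε • x + ε • y) ∂γ') - η) ∂γ'
        ≤ ∫ x, (∫ y, lse (w + ε • x + ε • y) ∂γ) ∂γ' :=
      integral_mono ((h'.integrable_lse_prod h' w ε).integral_prod_left.sub (integrable_const _))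
        (h'.integrable_lse_prod h w ε).integral_prod_left fun x => hε _
    rw [integral_sub (h'.integrable_lse_prod h' w ε).integral_prod_left
      (integrable_const _)] at this
    simpa using this
  linarith

lemma abs_integral_lse_smul_le (h : IsGaussField γ C) (w : ι → ℝ) {ε : ℝ} (hε : 0 ≤ ε) :
    |∫ x, lse (w + ε • x) ∂γ - lse w - ε ^ 2 / 2 * (∑ a, softmax w a * C a a
      - ∑ a, ∑ b, softmax w a * softmax w b * C a b)| ≤ ε ^ 3 * (6 * ∫ x, ‖x‖ ^ 3 ∂γ) := by
  have := h.prob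
  have key := abs_integral_lse_expansion_le (P := γ) (X := fun x => ε • x)
    (N := fun x => ε * ‖x‖) (by fun_prop) (by fun_prop)
    (by simpa only [mul_pow] using h.cube.const_mul (ε ^ 3)) (fun x a => by
      simp only [Pi.smul_apply, smul_eq_mul, abs_mul, abs_of_nonneg hε]
      exact mul_le_mul_of_nonneg_left (norm_le_pi_norm x a) hε) w
  have e2 : ∀ a b, ∫ x : ι → ℝ, (ε • x) a * (ε • x) b ∂γ = ε ^ 2 * C a b := by
    intro a b
    rw [← h.cov, ← integral_const_mul]
    refine integral_congr_ae (ae_of_all _ fun x => ?_)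
    simp only [Pi.smul_apply, smul_eq_mul]; ring
  have e1 : ∀ a, ∫ x : ι → ℝ, (ε • x) a ∂γ = 0 := by
    intro a
    simp only [Pi.smul_apply, smul_eq_mul]
    rw [integral_const_mul, h.mean, mul_zero]
  simp only [e1, e2, mul_pow] at key
  rw [integral_const_mul] at key
  convert key using 1
  · congr 1
    simp only [mul_zero, Finset.sum_const_zero, sub_zero]
    have : ∀ a b, softmax w a * softmax w b * (ε ^ 2 * C a b)
      = ε ^ 2 * (softmax w a * softmax w b * C a b) := fun a b => by ring
    have h' : ∀ a, softmax w a * (ε ^ 2 * C a a) = ε ^ 2 * (softmax w a * C a a) :=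
      fun a => by ring
    simp only [this, h', ← Finset.mul_sum]
    ring
  · ring

/-- Comparison of the mean log-partition functions of two Gaussian fields in terms of their
covariances. -/
theorem integral_lse_sub_le (h : IsGaussField γ C) (h' : IsGaussField γ' C') {K L : ℝ}
    (hdiag : ∀ a, C' a a - C a a ≤ K) (hoff : ∀ a b, C a b - C' a b ≤ L) :
    ∫ x, lse x ∂γ' - (K + L) / 2 ≤ ∫ x, lse x ∂γ := by
  set c : ℝ := 6 * ∫ x, ‖x‖ ^ 3 ∂γ + 6 * ∫ x, ‖x‖ ^ 3 ∂γ' with hc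
  have small : ∀ ε : ℝ, 0 ≤ ε → ∀ w, ∫ x, lse (w + ε • x) ∂γ'
      - (ε ^ 2 * ((K + L) / 2) + c * ε ^ 3) ≤ ∫ x, lse (w + ε • x) ∂γ := by
    intro ε hε w
    have b1 := abs_le.1 (h.abs_integral_lse_smul_le w hε)
    have b2 := abs_le.1 (h'.abs_integral_lse_smul_le w hε)
    have d1 : ∑ a, softmax w a * C' a a ≤ ∑ a, softmax w a * C a a + K := by
      calc ∑ a, softmax w a * C' a a ≤ ∑ a, (softmax w a * C a a + softmax w a * K) := by
            refine Finset.sum_le_sum fun a _ => ?_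
            rw [← mul_add]
            exact mul_le_mul_of_nonneg_left (by linarith [hdiag a]) (softmax_nonneg w a)
        _ = _ := by rw [Finset.sum_add_distrib, ← Finset.sum_mul, sum_softmax, one_mul]
    have d2 : ∑ a, ∑ b, softmax w a * softmax w b * C a b
        ≤ ∑ a, ∑ b, softmax w a * softmax w b * C' a b + L := by
      calc ∑ a, ∑ b, softmax w a * softmax w b * C a b
          ≤ ∑ a, ∑ b, (softmax w a * softmax w b * C' a b + softmax w a * softmax w b * L) := by
            refine Finset.sum_le_sum fun a _ => Finset.sum_le_sum fun b _ => ?_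
            rw [← mul_add]
            exact mul_le_mul_of_nonneg_left (by linarith [hoff a b])
              (mul_nonneg (softmax_nonneg w a) (softmax_nonneg w b))
        _ = _ := by
            simp_rw [Finset.sum_add_distrib, ← Finset.sum_mul, ← Finset.mul_sum, sum_softmax]
            simp [sum_softmax]
    have hε2 : 0 ≤ ε ^ 2 / 2 := by positivity
    have d3 := mul_le_mul_of_nonneg_left d1 hε2
    have d4 := mul_le_mul_of_nonneg_left d2 hε2
    rw [hc]
    nlinarith [b1.1, b2.2]
  have iter : ∀ (k : ℕ) (ε η : ℝ),
      (∀ w, ∫ x, lse (w + ε • x) ∂γ' - η ≤ ∫ x, lse (w + ε • x) ∂γ) →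
      ∀ w, ∫ x, lse (w + (√2 ^ k * ε) • x) ∂γ' - 2 ^ k * η
        ≤ ∫ x, lse (w + (√2 ^ k * ε) • x) ∂γ := by
    intro k
    induction k with
    | zero => intro ε η hη w; simpa using hη w
    | succ k ih =>
      intro ε η hη w
      have := h.lse_doubling h' (ih ε η hη) w
      have e1 : √2 ^ (k + 1) * ε = √2 * (√2 ^ k * ε) := by ring
      have e2 : (2 : ℝ) ^ (k + 1) * η = 2 * (2 ^ k * η) := by ring
      rw [e1, e2]
      exact this
  have bound : ∀ k : ℕ, ∫ x, lse x ∂γ' - ((K + L) / 2 + c * ((√2)⁻¹) ^ k) ≤ ∫ x, lse x ∂γ := by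
    intro k
    have hs : (√2 : ℝ) ≠ 0 := by positivity
    have := iter k (((√2)⁻¹) ^ k) _ (small _ (by positivity)) 0
    have e1 : √2 ^ k * ((√2)⁻¹) ^ k = 1 := by rw [← mul_pow, mul_inv_cancel₀ hs, one_pow]
    have e2 : (2 : ℝ) ^ k * (((√2)⁻¹) ^ k) ^ 2 = 1 := by
      rw [← pow_mul, mul_comm k 2, pow_mul, ← mul_pow, inv_pow, Real.sq_sqrt (by norm_num)]
      norm_num
    have e3 : (2 : ℝ) ^ k * ((((√2)⁻¹) ^ k) ^ 2 * ((K + L) / 2) + c * (((√2)⁻¹) ^ k) ^ 3)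
        = (K + L) / 2 + c * ((√2)⁻¹) ^ k := by
      linear_combination ((K + L) / 2 + c * ((√2)⁻¹) ^ k) * e2
    rw [e1, e3] at this
    simpa using this
  have hlim : Tendsto (fun k : ℕ => ∫ x, lse x ∂γ' - ((K + L) / 2 + c * ((√2)⁻¹) ^ k)) atTop
      (nhds (∫ x, lse x ∂γ' - ((K + L) / 2 + c * 0))) := by
    refine tendsto_const_nhds.sub (tendsto_const_nhds.add (tendsto_const_nhds.mul ?_))
    refine tendsto_pow_atTop_nhds_zero_of_lt_one (by positivity) ?_
    exact inv_lt_one_of_one_lt₀ (Real.lt_sqrt_of_sq_lt (by norm_num))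
  have := le_of_tendsto' hlim bound
  simpa using this

end IsGaussField

end GaussianComparison

section Lindeberg

section Replacement

variable {E : Type*} [MeasurableSpace E] {μ ν : Measure E} [IsProbabilityMeasure μ]
  [IsProbabilityMeasure ν] {G : E → ℝ}

private lemma integrable_cons_prod {μ₁ μ₂ : Measure E} [IsProbabilityMeasure μ₁]
    [IsProbabilityMeasure μ₂] (h₁ : Integrable G μ₁) (h₂ : Integrable G μ₂) {n : ℕ}
    {f : (Fin (n + 1) → E) → ℝ} (hf : Measurable f) {c : ℝ} (hb : ∀ x, |f x| ≤ c + ∑ i, G (x i)) :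
    Integrable (fun p : E × (Fin n → E) => f (Fin.cons p.1 p.2))
      (μ₁.prod (Measure.pi fun _ => μ₂)) := by
  have hG : Integrable (fun p : E × (Fin n → E) => c + (G p.1 + ∑ i, G (p.2 i)))
      (μ₁.prod (Measure.pi fun _ => μ₂)) := by
    refine (integrable_const c).add ((h₁.comp_fst _).add (integrable_finsetSum _ fun i _ => ?_))
    exact (integrable_comp_eval (μ := fun _ : Fin n => μ₂) (i := i) h₂).comp_snd μ₁
  have hm : Measurable fun p : E × (Fin n → E) => (Fin.cons p.1 p.2 : Fin (n + 1) → E) := by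
    rw [measurable_pi_iff]
    intro i
    refine Fin.cases ?_ (fun j => ?_) i
    · simpa using measurable_fst
    · simp only [Fin.cons_succ]
      exact (measurable_pi_apply j).comp measurable_snd
  refine hG.mono' (hf.comp hm).aestronglyMeasurable (ae_of_all _ fun p => ?_)
  have := hb (Fin.cons p.1 p.2)
  rw [Fin.sum_univ_succ] at this
  simpa using this

private lemma integral_pi_succ {n : ℕ} (f : (Fin (n + 1) → E) → ℝ) :
    ∫ x, f x ∂(Measure.pi fun _ => μ)
      = ∫ p : E × (Fin n → E), f (Fin.cons p.1 p.2) ∂(μ.prod (Measure.pi fun _ => μ)) := by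
  rw [← (measurePreserving_piFinSuccAbove (fun _ : Fin (n + 1) => μ) 0).symm.integral_comp']
  refine integral_congr_ae (ae_of_all _ fun p => ?_)
  exact congrArg f (Fin.insertNth_zero' p.1 p.2)

/-- Replacing the coordinates of a product measure one by one. -/
theorem abs_integral_pi_sub_le (hμ : Integrable G μ) (hν : Integrable G ν) {δ : ℝ} (n : ℕ) :
    ∀ (f : (Fin n → E) → ℝ) (c : ℝ), Measurable f → (∀ x, |f x| ≤ c + ∑ i, G (x i)) →
    (∀ x i, |∫ y, f (Function.update x i y) ∂μ - ∫ y, f (Function.update x i y) ∂ν| ≤ δ) →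
    |∫ x, f x ∂(Measure.pi fun _ => μ) - ∫ x, f x ∂(Measure.pi fun _ => ν)| ≤ n * δ := by
  induction n with
  | zero =>
    intro f c _ _ _
    have e : (Measure.pi fun _ : Fin 0 => μ) = Measure.pi fun _ => ν := by
      rw [Measure.pi_of_empty, Measure.pi_of_empty]
    simp [e]
  | succ n ih =>
    intro f c hf hb hδ
    rw [integral_pi_succ, integral_pi_succ]
    have i1 := integrable_cons_prod hμ hμ hf hb
    have i2 := integrable_cons_prod hμ hν hf hb
    have i3 := integrable_cons_prod hν hν hf hb
    have s1 : |∫ p : E × (Fin n → E), f (Fin.cons p.1 p.2) ∂(μ.prod (Measure.pi fun _ => μ))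
        - ∫ p : E × (Fin n → E), f (Fin.cons p.1 p.2) ∂(μ.prod (Measure.pi fun _ => ν))|
        ≤ n * δ := by
      rw [integral_prod _ i1, integral_prod _ i2,
        ← integral_sub i1.integral_prod_left i2.integral_prod_left, ← Real.norm_eq_abs]
      refine (norm_integral_le_of_norm_le_const (C := n * δ) (ae_of_all _ fun y => ?_)).trans
        (by simp)
      refine ih (fun x => f (Fin.cons y x)) (c + G y) ?_ (fun x => ?_) (fun x i => ?_)
      · refine hf.comp ?_
        rw [measurable_pi_iff]
        intro i
        refine Fin.cases ?_ (fun j => ?_) i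
        · simp
        · simpa using measurable_pi_apply j
      · have := hb (Fin.cons y x)
        rw [Fin.sum_univ_succ] at this
        simpa [add_assoc] using this
      · have := hδ (Fin.cons y x) i.succ
        simpa [Fin.cons_update] using this
    have s2 : |∫ p : E × (Fin n → E), f (Fin.cons p.1 p.2) ∂(μ.prod (Measure.pi fun _ => ν))
        - ∫ p : E × (Fin n → E), f (Fin.cons p.1 p.2) ∂(ν.prod (Measure.pi fun _ => ν))|
        ≤ δ := by
      rw [integral_prod_symm _ i2, integral_prod_symm _ i3,
        ← integral_sub i2.integral_prod_right i3.integral_prod_right, ← Real.norm_eq_abs]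
      refine (norm_integral_le_of_norm_le_const (C := δ) (ae_of_all _ fun x => ?_)).trans
        (by simp)
      obtain ⟨y₀⟩ : Nonempty E := nonempty_of_isProbabilityMeasure μ
      have := hδ (Fin.cons y₀ x) 0
      simpa [Fin.update_cons_zero] using this
    have := abs_sub_le
      (∫ p : E × (Fin n → E), f (Fin.cons p.1 p.2) ∂(μ.prod (Measure.pi fun _ => μ)))
      (∫ p : E × (Fin n → E), f (Fin.cons p.1 p.2) ∂(μ.prod (Measure.pi fun _ => ν)))
      (∫ p : E × (Fin n → E), f (Fin.cons p.1 p.2) ∂(ν.prod (Measure.pi fun _ => ν)))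
    push_cast
    linarith

end Replacement

lemma abs_integral_lse_line_sub_le {ι : Type*} [Fintype ι] [Nonempty ι] {μ ν : Measure ℝ}
    [IsProbabilityMeasure μ] [IsProbabilityMeasure ν] {m v : ℝ}
    (hμ3 : Integrable (fun y => |y - m| ^ 3) μ) (hν3 : Integrable (fun y => |y - m| ^ 3) ν)
    (hμ1 : ∫ y, (y - m) ∂μ = 0) (hν1 : ∫ y, (y - m) ∂ν = 0)
    (hμ2 : ∫ y, (y - m) ^ 2 ∂μ = v) (hν2 : ∫ y, (y - m) ^ 2 ∂ν = v)
    (w u : ι → ℝ) {B : ℝ} (hu : ∀ a, |u a| ≤ B) :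
    |∫ y, lse (w + (y - m) • u) ∂μ - ∫ y, lse (w + (y - m) • u) ∂ν|
      ≤ 6 * B ^ 3 * (∫ y, |y - m| ^ 3 ∂μ + ∫ y, |y - m| ^ 3 ∂ν) := by
  have main : ∀ (ρ : Measure ℝ) [IsProbabilityMeasure ρ], Integrable (fun y => |y - m| ^ 3) ρ →
      ∫ y, (y - m) ∂ρ = 0 → ∫ y, (y - m) ^ 2 ∂ρ = v →
      |∫ y, lse (w + (y - m) • u) ∂ρ - (lse w + (∑ a, softmax w a * (v * (u a * u a))
        - ∑ a, ∑ b, softmax w a * softmax w b * (v * (u a * u b))) / 2)|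
        ≤ 6 * B ^ 3 * ∫ y, |y - m| ^ 3 ∂ρ := by
    intro ρ _ h3 h1 h2
    have key := abs_integral_lse_expansion_le (P := ρ) (X := fun y => (y - m) • u)
      (N := fun y => B * |y - m|) (by fun_prop) (by fun_prop)
      (by simpa only [mul_pow] using h3.const_mul (B ^ 3)) (fun y a => by
        simp only [Pi.smul_apply, smul_eq_mul, abs_mul]
        rw [mul_comm]
        exact mul_le_mul_of_nonneg_right (hu a) (abs_nonneg _)) w
    have e1 : ∀ a, ∫ y : ℝ, ((y - m) • u) a ∂ρ = 0 := by
      intro a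
      simp only [Pi.smul_apply, smul_eq_mul]
      rw [integral_mul_const, h1, zero_mul]
    have e2 : ∀ a b, ∫ y : ℝ, ((y - m) • u) a * ((y - m) • u) b ∂ρ = v * (u a * u b) := by
      intro a b
      rw [← h2, ← integral_mul_const]
      refine integral_congr_ae (ae_of_all _ fun y => ?_)
      simp only [Pi.smul_apply, smul_eq_mul]; ring
    simp only [e1, e2, mul_pow, integral_const_mul] at key
    simp only [mul_zero, Finset.sum_const_zero, sub_zero] at key
    rw [mul_assoc, ← sub_sub]
    exact key
  have a := abs_le.1 (main μ hμ3 hμ1 hμ2)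
  have b := abs_le.1 (main ν hν3 hν1 hν2)
  rw [abs_le]
  constructor <;> linarith [a.1, a.2, b.1, b.2]

/-- The exponents `-β H(σ; X)` of the Boltzmann weights. -/
noncomputable def boltz {n : ℕ} (β : ℝ) (X : Fin n → Fin n → ℝ) (σ : Fin n → Bool) : ℝ :=
  -β * Ham X σ

lemma abs_spin (b : Bool) : |spin b| = 1 := by
  cases b <;> simp [spin]

lemma spin_mul_self (b : Bool) : spin b * spin b = 1 := by
  cases b <;> simp [spin]

lemma abs_Ham_le {n : ℕ} (X : Fin n → Fin n → ℝ) (σ : Fin n → Bool) :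
    |Ham X σ| ≤ ∑ i, ∑ j, |X i j| := by
  refine (Finset.abs_sum_le_sum_abs _ _).trans (Finset.sum_le_sum fun i _ => ?_)
  refine (Finset.abs_sum_le_sum_abs _ _).trans (Finset.sum_le_sum fun j _ => ?_)
  simp [abs_mul, abs_spin]

lemma abs_boltz_le {n : ℕ} (β : ℝ) (X : Fin n → Fin n → ℝ) (σ : Fin n → Bool) :
    |boltz β X σ| ≤ |β| * ∑ i, ∑ j, |X i j| := by
  rw [boltz, abs_mul, abs_neg]
  exact mul_le_mul_of_nonneg_left (abs_Ham_le X σ) (abs_nonneg _)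

lemma measurable_Ham {n : ℕ} (σ : Fin n → Bool) :
    Measurable fun X : Fin n → Fin n → ℝ => Ham X σ := by
  unfold Ham
  fun_prop

lemma measurable_boltz {n : ℕ} (β : ℝ) :
    Measurable (boltz β : (Fin n → Fin n → ℝ) → (Fin n → Bool) → ℝ) := by
  rw [measurable_pi_iff]
  exact fun σ => (measurable_Ham σ).const_mul _

lemma boltz_update {n : ℕ} (β : ℝ) (X : Fin n → Fin n → ℝ) (i : Fin n) (r : Fin n → ℝ) (j : Fin n)
    (m y : ℝ) : boltz β (Function.update X i (Function.update r j y))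
      = boltz β (Function.update X i (Function.update r j m))
        + (y - m) • fun σ => -β * (spin (σ i) * spin (σ j)) := by
  funext σ
  have key : ∀ z, Ham (Function.update X i (Function.update r j z)) σ
      = Ham (Function.update X i (Function.update r j 0)) σ + z * (spin (σ i) * spin (σ j)) := by
    intro z
    rw [← sub_eq_iff_eq_add']
    unfold Ham
    rw [← Finset.sum_sub_distrib, Finset.sum_eq_single i]
    · rw [← Finset.sum_sub_distrib, Finset.sum_eq_single j]
      · simp; ring
      · intro k _ hk; simp [hk]
      · simp
    · intro k _ hk; simp [hk]
    · simp
  simp only [boltz, Pi.add_apply, Pi.smul_apply, smul_eq_mul]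
  rw [key y, key m]
  ring

lemma abs_lse_boltz_le {n : ℕ} (β : ℝ) (X : Fin n → Fin n → ℝ) :
    |lse (boltz β X)| ≤ |lse (0 : (Fin n → Bool) → ℝ)| + ∑ i, ∑ j, |β| * |X i j| := by
  have h := abs_lse_add_sub_le 0 (boltz β X) (abs_boltz_le β X)
  rw [zero_add] at h
  have h2 := abs_sub_abs_le_abs_sub (lse (boltz β X))
    (lse (0 : (Fin n → Bool) → ℝ))
  simp_rw [← Finset.mul_sum]
  linarith

/-- Universality: the mean log-partition function depends on the entry distribution only through
its first two moments, up to third moments. -/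
theorem abs_integral_lse_boltz_sub_le {n : ℕ} (β : ℝ) {μ ν : Measure ℝ}
    [IsProbabilityMeasure μ] [IsProbabilityMeasure ν] {m v : ℝ}
    (hμ : Integrable (fun y => |y|) μ) (hν : Integrable (fun y => |y|) ν)
    (hμ3 : Integrable (fun y => |y - m| ^ 3) μ) (hν3 : Integrable (fun y => |y - m| ^ 3) ν)
    (hμ1 : ∫ y, (y - m) ∂μ = 0) (hν1 : ∫ y, (y - m) ∂ν = 0)
    (hμ2 : ∫ y, (y - m) ^ 2 ∂μ = v) (hν2 : ∫ y, (y - m) ^ 2 ∂ν = v) :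
    |∫ X : Fin n → Fin n → ℝ, lse (boltz β X) ∂(Measure.pi fun _ => Measure.pi fun _ => μ)
      - ∫ X : Fin n → Fin n → ℝ, lse (boltz β X) ∂(Measure.pi fun _ => Measure.pi fun _ => ν)|
      ≤ n * (n * (6 * |β| ^ 3 * (∫ y, |y - m| ^ 3 ∂μ + ∫ y, |y - m| ^ 3 ∂ν))) := by
  have hrow : ∀ (ρ : Measure ℝ) [IsProbabilityMeasure ρ], Integrable (fun y => |y|) ρ →
      Integrable (fun r : Fin n → ℝ => ∑ j, |β| * |r j|) (Measure.pi fun _ => ρ) := by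
    intro ρ _ h
    exact integrable_finsetSum _ fun j _ =>
      (integrable_comp_eval (μ := fun _ : Fin n => ρ) (i := j) h).const_mul _
  refine abs_integral_pi_sub_le (hrow μ hμ) (hrow ν hν) n _ |lse (0 : (Fin n → Bool) → ℝ)|
    (measurable_lse.comp (measurable_boltz β)) (abs_lse_boltz_le β) fun X i => ?_
  refine abs_integral_pi_sub_le (hμ.const_mul |β|) (hν.const_mul |β|) n _
    (|lse (0 : (Fin n → Bool) → ℝ)| + ∑ k ∈ Finset.univ.erase i, ∑ j, |β| * |X k j|)
    ((measurable_lse.comp (measurable_boltz β)).comp (measurable_update X)) (fun r => ?_)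
    fun r j => ?_
  · refine (abs_lse_boltz_le β _).trans (le_of_eq ?_)
    rw [← Finset.add_sum_erase _ _ (Finset.mem_univ i), add_assoc, Function.update_self,
      add_comm (∑ j, |β| * |r j|)]
    congr 2
    refine Finset.sum_congr rfl fun k hk => ?_
    rw [Function.update_of_ne (Finset.ne_of_mem_erase hk)]
  · have key := abs_integral_lse_line_sub_le hμ3 hν3 hμ1 hν1 hμ2 hν2
      (boltz β (Function.update X i (Function.update r j m)))
      (fun σ => -β * (spin (σ i) * spin (σ j))) (B := |β|) fun σ => by simp [abs_mul, abs_spin]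
    simp only [← boltz_update β X i r j m] at key
    exact key

end Lindeberg

section GaussianFields

instance isGaussian_pi {κ : Type*} [Fintype κ] {E : κ → Type*} [∀ k, NormedAddCommGroup (E k)]
    [∀ k, NormedSpace ℝ (E k)] [∀ k, MeasurableSpace (E k)] [∀ k, CompleteSpace (E k)]
    [∀ k, BorelSpace (E k)] [∀ k, SecondCountableTopology (E k)] (μ : ∀ k, Measure (E k))
    [∀ k, IsGaussian (μ k)] : IsGaussian (Measure.pi μ) := by
  have h := iIndepFun.hasGaussianLaw (P := Measure.pi μ) (X := fun k x => x k) (fun k => ?_)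
    (iIndepFun_pi (X := fun k (x : E k) => x) fun k => aemeasurable_id)
  · simpa using h.isGaussian_map
  · have := (measurePreserving_eval μ k).map_eq
    exact ⟨by rw [show (fun x : ∀ k, E k => x k) = Function.eval k from rfl, this]; infer_instance⟩

/-- A centered Gaussian measure is a fixed point of the central limit renormalization. -/
lemma map_sqrt_two_inv_smul_add {E : Type*} [NormedAddCommGroup E] [NormedSpace ℝ E]
    [MeasurableSpace E] [BorelSpace E] [SecondCountableTopology E] [CompleteSpace E]
    (γ : Measure E) [IsGaussian γ] (h0 : ∫ x, x ∂γ = 0) :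
    (γ.prod γ).map (fun p => (√2)⁻¹ • (p.1 + p.2)) = γ := by
  have h1 : (γ.prod γ).map (fun p => (√2)⁻¹ • (p.1 + p.2))
      = (γ ∗ γ).map ((√2)⁻¹ • ContinuousLinearMap.id ℝ E) := by
    rw [Measure.conv, Measure.map_map (by fun_prop) (by fun_prop)]
    rfl
  rw [h1]
  apply Measure.ext_of_charFunDual
  ext L
  have hL : ∀ M : StrongDual ℝ E, (∫ x, ((M x : ℝ) : ℂ) ∂γ) = 0 := by
    intro M
    have : ∫ x, M x ∂γ = 0 := by
      rw [M.integral_comp_comm (φ := fun x => x) ((IsGaussian.memLp_id γ 1 (by simp)).integrable le_rfl)]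
      simp [h0]
    rw [integral_complex_ofReal, this, Complex.ofReal_zero]
  rw [charFunDual_map, charFunDual_conv, IsGaussian.charFunDual_eq, IsGaussian.charFunDual_eq, hL,
    hL, ← Complex.exp_add]
  congr 1
  have h2 : (L ∘SL ((√2)⁻¹ • ContinuousLinearMap.id ℝ E) : E → ℝ) = fun x => (√2)⁻¹ * L x := by
    ext x; simp
  rw [h2, variance_const_mul, inv_pow, Real.sq_sqrt (by norm_num)]
  push_cast
  ring

variable {ι : Type*} [Fintype ι]

lemma IsGaussField.of_isGaussian {γ : Measure (ι → ℝ)} [IsGaussian γ] {C : ι → ι → ℝ}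
    (hm : ∀ a, ∫ x, x a ∂γ = 0) (hc : ∀ a b, ∫ x, x a * x b ∂γ = C a b) : IsGaussField γ C where
  prob := inferInstance
  stable := by
    apply map_sqrt_two_inv_smul_add
    funext a
    rw [eval_integral fun i => ?_, hm, Pi.zero_apply]
    have := (IsGaussian.memLp_id γ 1 (by simp)).integrable le_rfl
    exact this.eval i
  cube := (IsGaussian.memLp_id γ 3 (by simp)).integrable_norm_pow (p := 3) (by norm_num)
  mean := hm
  cov := hc

lemma IsGaussField.map_linear {E : Type*} [NormedAddCommGroup E] [NormedSpace ℝ E]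
    [FiniteDimensional ℝ E] [MeasurableSpace E] [BorelSpace E] {P : Measure E} [IsGaussian P]
    (T : E →ₗ[ℝ] ι → ℝ) {C : ι → ι → ℝ} (hm : ∀ a, ∫ z, T z a ∂P = 0)
    (hc : ∀ a b, ∫ z, T z a * T z b ∂P = C a b) : IsGaussField (P.map T) C := by
  have hT : Measurable T := (LinearMap.continuous_of_finiteDimensional T).measurable
  have : IsGaussian (P.map T) := isGaussian_map (LinearMap.toContinuousLinearMap T)
  refine .of_isGaussian (fun a => ?_) fun a b => ?_
  · rw [integral_map hT.aemeasurable (measurable_pi_apply a).aestronglyMeasurable]; exact hm a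
  · rw [integral_map (f := fun x => x a * x b) hT.aemeasurable
      ((measurable_pi_apply a).mul (measurable_pi_apply b)).aestronglyMeasurable]
    exact hc a b

end GaussianFields

lemma integral_pi_sum_mul_sum {κ : Type*} [Fintype κ] {E : κ → Type*} [∀ k, MeasurableSpace (E k)]
    (μ : ∀ k, Measure (E k)) [∀ k, IsProbabilityMeasure (μ k)] {f g : ∀ k, E k → ℝ}
    (hf : ∀ k, MemLp (f k) 2 (μ k)) (hg : ∀ k, MemLp (g k) 2 (μ k)) (h0 : ∀ k, ∫ x, f k x ∂μ k = 0) :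
    ∫ x, (∑ k, f k (x k)) * ∑ k, g k (x k) ∂Measure.pi μ = ∑ k, ∫ x, f k x * g k x ∂μ k := by
  classical
  have hf' : ∀ k, MemLp (fun x : ∀ k, E k => f k (x k)) 2 (Measure.pi μ) := fun k =>
    (hf k).comp_measurePreserving (measurePreserving_eval μ k)
  have hg' : ∀ k, MemLp (fun x : ∀ k, E k => g k (x k)) 2 (Measure.pi μ) := fun k =>
    (hg k).comp_measurePreserving (measurePreserving_eval μ k)
  have hi : ∀ k l, Integrable (fun x : ∀ k, E k => f k (x k) * g l (x l)) (Measure.pi μ) :=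
    fun k l => (hf' k).integrable_mul (hg' l)
  simp_rw [Finset.sum_mul_sum]
  rw [integral_finsetSum _ fun k _ => integrable_finsetSum _ fun l _ => hi k l]
  refine Finset.sum_congr rfl fun k _ => ?_
  rw [integral_finsetSum _ fun l _ => hi k l, Finset.sum_eq_single k]
  · exact integral_comp_eval (f := fun y => f k y * g k y)
      ((hf k).aestronglyMeasurable.mul (hg k).aestronglyMeasurable)
  · intro l _ hl
    have hind : IndepFun (fun x : ∀ k, E k => f k (x k)) (fun x => g l (x l)) (Measure.pi μ) := by
      have h := (iIndepFun_pi (μ := μ) (X := fun k (x : E k) => (f k x, g k x))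
        fun k => (hf k).aemeasurable.prodMk (hg k).aemeasurable).indepFun hl.symm
      exact h.comp measurable_fst measurable_snd
    rw [hind.integral_fun_mul_eq_mul_integral (hf' k).aestronglyMeasurable
      (hg' l).aestronglyMeasurable, integral_comp_eval (hf k).aestronglyMeasurable, h0, zero_mul]
  · simp

instance isGaussian_skMeasure (n : ℕ) : IsGaussian (skMeasure n) := by
  unfold skMeasure; infer_instance

lemma integral_pi_sum_zero {κ : Type*} [Fintype κ] {E : κ → Type*} [∀ k, MeasurableSpace (E k)]
    (μ : ∀ k, Measure (E k)) [∀ k, IsProbabilityMeasure (μ k)] {f : ∀ k, E k → ℝ}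
    (hf : ∀ k, Integrable (f k) (μ k)) (h0 : ∀ k, ∫ x, f k x ∂μ k = 0) :
    ∫ x, ∑ k, f k (x k) ∂Measure.pi μ = 0 := by
  rw [integral_finsetSum _ fun k _ => integrable_comp_eval (hf k)]
  exact Finset.sum_eq_zero fun k _ => by
    rw [integral_comp_eval (hf k).aestronglyMeasurable, h0]

lemma memLp_sum_row {n : ℕ} (v : NNReal) (c : Fin n → ℝ) :
    MemLp (fun r : Fin n → ℝ => ∑ j, c j * r j) 2
      (Measure.pi fun _ => gaussianReal 0 v) := by
  refine memLp_finsetSum _ fun j _ => MemLp.const_mul ?_ _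
  exact (memLp_id_gaussianReal 2).comp_measurePreserving
    (measurePreserving_eval (fun _ : Fin n => gaussianReal 0 v) j)

lemma integral_row {n : ℕ} (v : NNReal) (c : Fin n → ℝ) :
    ∫ r : Fin n → ℝ, ∑ j, c j * r j ∂(Measure.pi fun _ => gaussianReal 0 v) = 0 :=
  integral_pi_sum_zero (fun _ : Fin n => gaussianReal 0 v) (f := fun j (y : ℝ) => c j * y)
    (fun j => ((memLp_id_gaussianReal 1).integrable le_rfl).const_mul (c j)) fun j => by
      rw [integral_const_mul, integral_id_gaussianReal, mul_zero]

lemma Ham_eq_sum_row {n : ℕ} (X : Fin n → Fin n → ℝ) (σ : Fin n → Bool) :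
    Ham X σ = ∑ i, ∑ j, spin (σ i) * spin (σ j) * X i j := by
  unfold Ham
  exact Finset.sum_congr rfl fun i _ => Finset.sum_congr rfl fun j _ => by ring

lemma integral_sq_gaussianReal (v : NNReal) : ∫ y, y * y ∂gaussianReal 0 v = v := by
  have h := variance_eq_sub (memLp_id_gaussianReal (μ := 0) (v := v) 2)
  rw [variance_id_gaussianReal] at h
  simp only [Pi.pow_apply, id, integral_id_gaussianReal] at h
  simp_rw [← sq]
  linarith

lemma integral_Ham_skMeasure {n : ℕ} (σ : Fin n → Bool) : ∫ g, Ham g σ ∂skMeasure n = 0 := by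
  simp_rw [Ham_eq_sum_row]
  exact integral_pi_sum_zero
    (fun _ : Fin n => Measure.pi fun _ : Fin n => gaussianReal 0 (1 / (2 * n))) (f := fun i (r : Fin n → ℝ) => ∑ j, spin (σ i) * spin (σ j) * r j)
    (fun i => (memLp_sum_row _ _).integrable (by norm_num)) fun i => integral_row _ _

lemma integral_Ham_mul_Ham_skMeasure {n : ℕ} (σ τ : Fin n → Bool) :
    ∫ g, Ham g σ * Ham g τ ∂skMeasure n
      = 1 / (2 * n) * (∑ i, spin (σ i) * spin (τ i)) ^ 2 := by
  simp_rw [Ham_eq_sum_row]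
  unfold skMeasure
  rw [integral_pi_sum_mul_sum
    (fun _ : Fin n => Measure.pi fun _ : Fin n => gaussianReal 0 (1 / (2 * n))) (f := fun i (r : Fin n → ℝ) => ∑ j, spin (σ i) * spin (σ j) * r j)
    (g := fun i (r : Fin n → ℝ) => ∑ j, spin (τ i) * spin (τ j) * r j)
    (fun i => memLp_sum_row _ _) (fun i => memLp_sum_row _ _) fun i => integral_row _ _]
  rw [sq, Finset.sum_mul_sum, Finset.mul_sum]
  refine Finset.sum_congr rfl fun i _ => ?_
  rw [integral_pi_sum_mul_sum (fun _ : Fin n => gaussianReal 0 (1 / (2 * n)))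
    (f := fun j (y : ℝ) => spin (σ i) * spin (σ j) * y)
    (g := fun j (y : ℝ) => spin (τ i) * spin (τ j) * y)
    (fun j => (memLp_id_gaussianReal 2).const_mul _) (fun j => (memLp_id_gaussianReal 2).const_mul _)
    fun j => by rw [integral_const_mul, integral_id_gaussianReal, mul_zero], Finset.mul_sum]
  refine Finset.sum_congr rfl fun j _ => ?_
  rw [show (fun y : ℝ => spin (σ i) * spin (σ j) * y * (spin (τ i) * spin (τ j) * y))
    = fun y => spin (σ i) * spin (τ i) * (spin (σ j) * spin (τ j)) * (y * y) by ext y; ring,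
    integral_const_mul, integral_sq_gaussianReal]
  push_cast
  ring

section SKFreeEnergy

lemma lse_comp_equiv {ι κ : Type*} [Fintype ι] [Fintype κ] (e : κ ≃ ι) (w : ι → ℝ) :
    lse (fun a => w (e a)) = lse w := by
  unfold lse
  rw [Equiv.sum_comp e fun a => Real.exp (w a)]

lemma lse_prod {ι κ : Type*} [Fintype ι] [Fintype κ] [Nonempty ι] [Nonempty κ] (w : ι → ℝ)
    (w' : κ → ℝ) : lse (fun a : ι × κ => w a.1 + w' a.2) = lse w + lse w' := by
  unfold lse
  rw [← Real.log_mul (sum_exp_pos w).ne' (sum_exp_pos w').ne', Finset.sum_mul_sum,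
    Fintype.sum_prod_type]
  simp_rw [Real.exp_add]

lemma lse_zero_bool (n : ℕ) : lse (0 : (Fin n → Bool) → ℝ) = n * Real.log 2 := by
  simp [lse]

lemma boltz_add {n : ℕ} (β : ℝ) (X Y : Fin n → Fin n → ℝ) (σ : Fin n → Bool) :
    boltz β (X + Y) σ = boltz β X σ + boltz β Y σ := by
  simp only [boltz, Ham, Pi.add_apply, add_mul, Finset.sum_add_distrib]
  ring

lemma boltz_smul {n : ℕ} (β c : ℝ) (X : Fin n → Fin n → ℝ) (σ : Fin n → Bool) :
    boltz β (c • X) σ = c * boltz β X σ := by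
  simp only [boltz, Ham, Pi.smul_apply, smul_eq_mul, mul_assoc, ← Finset.mul_sum]
  ring

/-- The unnormalized overlap. -/
noncomputable def dotSpin {n : ℕ} (σ τ : Fin n → Bool) : ℝ := ∑ i, spin (σ i) * spin (τ i)

lemma dotSpin_self {n : ℕ} (σ : Fin n → Bool) : dotSpin σ σ = n := by
  simp [dotSpin, spin_mul_self]

lemma abs_dotSpin_le {n : ℕ} (σ τ : Fin n → Bool) : |dotSpin σ τ| ≤ n := by
  refine (Finset.abs_sum_le_sum_abs _ _).trans ?_
  simp [abs_mul, abs_spin]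

lemma dotSpin_append {n m : ℕ} (σ τ : Fin n → Bool) (σ' τ' : Fin m → Bool) :
    dotSpin (Fin.append σ σ') (Fin.append τ τ') = dotSpin σ τ + dotSpin σ' τ' := by
  simp [dotSpin, Fin.sum_univ_add]

lemma memLp_boltz_skMeasure {n : ℕ} (β : ℝ) (σ : Fin n → Bool) :
    MemLp (fun g => boltz β g σ) 2 (skMeasure n) := by
  have h := IsGaussian.memLp_id (skMeasure n) 2 (by simp)
  refine MemLp.const_mul ?_ (-β)
  unfold Ham
  refine memLp_finsetSum _ fun i _ => memLp_finsetSum _ fun j _ => ?_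
  simp_rw [mul_assoc]
  exact ((h.eval i).eval j).mul_const _

lemma integral_boltz_skMeasure {n : ℕ} (β : ℝ) (σ : Fin n → Bool) :
    ∫ g, boltz β g σ ∂skMeasure n = 0 := by
  unfold boltz
  rw [integral_const_mul, integral_Ham_skMeasure, mul_zero]

lemma integral_boltz_mul_boltz_skMeasure {n : ℕ} (β : ℝ) (σ τ : Fin n → Bool) :
    ∫ g, boltz β g σ * boltz β g τ ∂skMeasure n = β ^ 2 * (1 / (2 * n) * dotSpin σ τ ^ 2) := by
  unfold boltz
  simp_rw [show ∀ g : Fin n → Fin n → ℝ, -β * Ham g σ * (-β * Ham g τ)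
    = β ^ 2 * (Ham g σ * Ham g τ) from fun g => by ring]
  rw [integral_const_mul, integral_Ham_mul_Ham_skMeasure]
  rfl

variable {α : Type*} [Fintype α]

/-- The linear map sending the disorder to the family of exponents of the configurations `π a`. -/
noncomputable def boltzLin {n : ℕ} (β : ℝ) (π : α → Fin n → Bool) :
    (Fin n → Fin n → ℝ) →ₗ[ℝ] α → ℝ where
  toFun g a := boltz β g (π a)
  map_add' X Y := funext fun a => boltz_add β X Y (π a)
  map_smul' c X := funext fun a => boltz_smul β c X (π a)

/-- The linear map sending a pair of disorders to the exponents of a non-interacting pair. -/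
noncomputable def boltzLinProd {n m : ℕ} (β β' : ℝ) (π : α → Fin n → Bool) (π' : α → Fin m → Bool) :
    (Fin n → Fin n → ℝ) × (Fin m → Fin m → ℝ) →ₗ[ℝ] α → ℝ where
  toFun p a := boltz β p.1 (π a) + boltz β' p.2 (π' a)
  map_add' X Y := funext fun a => by
    simp only [Prod.fst_add, Prod.snd_add, boltz_add, Pi.add_apply]
    ring
  map_smul' c X := funext fun a => by
    simp only [Prod.smul_fst, Prod.smul_snd, boltz_smul, Pi.smul_apply, smul_eq_mul,
      RingHom.id_apply]
    ring

lemma isGaussField_sk {n : ℕ} (β : ℝ) (π : α → Fin n → Bool) :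
    IsGaussField ((skMeasure n).map (boltzLin β π))
      fun a b => β ^ 2 * (1 / (2 * n) * dotSpin (π a) (π b) ^ 2) :=
  .map_linear _ (fun a => integral_boltz_skMeasure β (π a)) fun a b =>
    integral_boltz_mul_boltz_skMeasure β (π a) (π b)

lemma isGaussField_sk_prod {n m : ℕ} (β β' : ℝ) (π : α → Fin n → Bool) (π' : α → Fin m → Bool) :
    IsGaussField (((skMeasure n).prod (skMeasure m)).map (boltzLinProd β β' π π'))
      fun a b => β ^ 2 * (1 / (2 * n) * dotSpin (π a) (π b) ^ 2)
        + β' ^ 2 * (1 / (2 * m) * dotSpin (π' a) (π' b) ^ 2) := by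
  have hi : ∀ a, MemLp (fun p : (Fin n → Fin n → ℝ) × (Fin m → Fin m → ℝ) => boltz β p.1 (π a)) 2
      ((skMeasure n).prod (skMeasure m)) := fun a =>
    (memLp_boltz_skMeasure β (π a)).comp_measurePreserving measurePreserving_fst
  have hi' : ∀ a, MemLp (fun p : (Fin n → Fin n → ℝ) × (Fin m → Fin m → ℝ) => boltz β' p.2 (π' a))
      2 ((skMeasure n).prod (skMeasure m)) := fun a =>
    (memLp_boltz_skMeasure β' (π' a)).comp_measurePreserving measurePreserving_snd
  refine .map_linear _ (fun a => ?_) fun a b => ?_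
  · change ∫ p : (Fin n → Fin n → ℝ) × (Fin m → Fin m → ℝ),
      (boltz β p.1 (π a) + boltz β' p.2 (π' a)) ∂_ = 0
    rw [integral_add ((hi a).integrable (by norm_num)) ((hi' a).integrable (by norm_num)),
      integral_fun_fst fun g => boltz β g (π a), integral_fun_snd fun g => boltz β' g (π' a),
      integral_boltz_skMeasure, integral_boltz_skMeasure]
    simp
  · change ∫ p : (Fin n → Fin n → ℝ) × (Fin m → Fin m → ℝ),
      (boltz β p.1 (π a) + boltz β' p.2 (π' a)) * (boltz β p.1 (π b) + boltz β' p.2 (π' b)) ∂_ = _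
    simp_rw [add_mul, mul_add]
    have h1 := (hi a).integrable_mul (hi b)
    have h2 := (hi a).integrable_mul (hi' b)
    have h3 := (hi' a).integrable_mul (hi b)
    have h4 := (hi' a).integrable_mul (hi' b)
    have e2 := integral_prod_mul (μ := skMeasure n) (ν := skMeasure m)
      (fun g => boltz β g (π a)) (fun g => boltz β' g (π' b))
    have e3 := integral_prod_mul (μ := skMeasure n) (ν := skMeasure m)
      (fun g => boltz β g (π b)) (fun g => boltz β' g (π' a))
    simp_rw [mul_comm (boltz β _ _) (boltz β' _ _)] at e3
    refine (integral_add (h1.add h2) (h3.add h4)).trans ?_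
    rw [integral_add' h1 h2, integral_add' h3 h4]
    simp only [Pi.mul_apply]
    rw [e2, e3,
      integral_fun_fst fun g => boltz β g (π a) * boltz β g (π b),
      integral_fun_snd fun g => boltz β' g (π' a) * boltz β' g (π' b),
      integral_boltz_mul_boltz_skMeasure, integral_boltz_mul_boltz_skMeasure]
    simp [integral_boltz_skMeasure]

/-- The SK free energy `E log Z`. -/
noncomputable def skFree (n : ℕ) (β : ℝ) : ℝ := ∫ g, lse (boltz β g) ∂skMeasure n

lemma integrable_lse_boltz_skMeasure (n : ℕ) (β : ℝ) :
    Integrable (fun g => lse (boltz β g)) (skMeasure n) := by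
  have h := (isGaussField_sk (n := n) β id).integrable_lse_smul 0 1
  simp only [zero_add, one_smul] at h
  exact h.comp_measurable (LinearMap.continuous_of_finiteDimensional _).measurable

/-- Comparison of a system with two independent blocks. -/
lemma skFree_add_le {n m : ℕ} (β b b' : ℝ) {K L : ℝ}
    (hK : b ^ 2 * (n / 2) + b' ^ 2 * (m / 2) - β ^ 2 * ((n + m) / 2) ≤ K)
    (hL : ∀ r r' : ℝ, |r| ≤ n → |r'| ≤ m → β ^ 2 * (1 / (2 * (n + m)) * (r + r') ^ 2)
      - (b ^ 2 * (1 / (2 * n) * r ^ 2) + b' ^ 2 * (1 / (2 * m) * r' ^ 2)) ≤ L) :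
    skFree n b + skFree m b' - (K + L) / 2 ≤ skFree (n + m) β := by
  have half : ∀ k : ℕ, 1 / (2 * (k : ℝ)) * (k : ℝ) ^ 2 = k / 2 := fun k => by
    rcases eq_or_ne (k : ℝ) 0 with h | h
    · simp [h]
    · field_simp
  have h := isGaussField_sk (n := n + m) β
    (fun a : (Fin n → Bool) × (Fin m → Bool) => Fin.append a.1 a.2)
  have h' := isGaussField_sk_prod (α := (Fin n → Bool) × (Fin m → Bool)) b b' Prod.fst Prod.snd
  have key := h.integral_lse_sub_le h' (K := K) (L := L) (fun a => ?_) fun a c => ?_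
  · rw [integral_map (LinearMap.continuous_of_finiteDimensional _).measurable.aemeasurable
      measurable_lse.aestronglyMeasurable, integral_map
      (LinearMap.continuous_of_finiteDimensional _).measurable.aemeasurable
      measurable_lse.aestronglyMeasurable] at key
    have e1 : ∀ g, lse (boltzLin β
        (fun a : (Fin n → Bool) × (Fin m → Bool) => Fin.append a.1 a.2) g) = lse (boltz β g) :=
      fun g => lse_comp_equiv (Fin.appendEquiv n m) (boltz β g)
    have e2 : ∀ p : (Fin n → Fin n → ℝ) × (Fin m → Fin m → ℝ),
        lse (boltzLinProd b b' (Prod.fst : (Fin n → Bool) × (Fin m → Bool) → _) Prod.snd p)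
        = lse (boltz b p.1) + lse (boltz b' p.2) := fun p => lse_prod _ _
    simp_rw [e1, e2] at key
    rw [integral_add ((integrable_lse_boltz_skMeasure n b).comp_fst _)
      ((integrable_lse_boltz_skMeasure m b').comp_snd _),
      integral_fun_fst fun g => lse (boltz b g), integral_fun_snd fun g => lse (boltz b' g)] at key
    simpa [skFree] using key
  · simp only [dotSpin_self, half]
    refine le_trans (le_of_eq ?_) hK
    push_cast
    ring
  · simp only [dotSpin_append]
    refine le_trans (le_of_eq ?_) (hL _ _ (abs_dotSpin_le a.1 c.1) (abs_dotSpin_le a.2 c.2))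
    push_cast
    ring

lemma skFree_superadditive (n m : ℕ) (β : ℝ) : skFree n β + skFree m β ≤ skFree (n + m) β := by
  have h := skFree_add_le (n := n) (m := m) β β β (K := 0) (L := 0) (by linarith)
    fun r r' hr hr' => ?_
  · linarith
  · rcases Nat.eq_zero_or_pos n with rfl | hn
    · have : r = 0 := by simpa using hr
      simp [this]
    rcases Nat.eq_zero_or_pos m with rfl | hm
    · have : r' = 0 := by simpa using hr'
      simp [this]
    have hn' : (0 : ℝ) < n := by exact_mod_cast hn
    have hm' : (0 : ℝ) < m := by exact_mod_cast hm
    have : β ^ 2 * (1 / (2 * (n + m)) * (r + r') ^ 2)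
      - (β ^ 2 * (1 / (2 * n) * r ^ 2) + β ^ 2 * (1 / (2 * m) * r' ^ 2))
      = - (β ^ 2 * (m * r - n * r') ^ 2 / (2 * n * m * (n + m))) := by
      field_simp; ring
    rw [this]
    exact neg_nonpos.mpr (by positivity)

lemma skFree_second_difference (n : ℕ) (β δ : ℝ) :
    skFree n (β + δ) + skFree n (β - δ) - 5 / 2 * n * δ ^ 2 ≤ skFree (n + n) β := by
  have h := skFree_add_le (n := n) (m := n) β (β + δ) (β - δ) (K := n * δ ^ 2)
    (L := 4 * n * δ ^ 2) (le_of_eq (by ring)) fun r r' hr hr' => ?_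
  · linarith
  · rcases Nat.eq_zero_or_pos n with rfl | hn
    · simp
    have hn' : (0 : ℝ) < n := by exact_mod_cast hn
    have h1 : (r + r') ^ 2 ≤ (2 * n) ^ 2 := sq_le_sq' (by linarith [(abs_le.1 hr).1, (abs_le.1 hr').1])
      (by linarith [(abs_le.1 hr).2, (abs_le.1 hr').2])
    have : β ^ 2 * (1 / (2 * (n + n)) * (r + r') ^ 2)
      - ((β + δ) ^ 2 * (1 / (2 * n) * r ^ 2) + (β - δ) ^ 2 * (1 / (2 * n) * r' ^ 2))
      = (4 * δ ^ 2 * (r + r') ^ 2 - (β * (r - r') + 2 * δ * (r + r')) ^ 2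
        - 2 * δ ^ 2 * (r ^ 2 + r' ^ 2)) / (4 * n) := by
      field_simp; ring
    rw [this, div_le_iff₀ (by positivity)]
    nlinarith [sq_nonneg (β * (r - r') + 2 * δ * (r + r')), sq_nonneg (δ * r), sq_nonneg (δ * r'),
      mul_le_mul_of_nonneg_left h1 (sq_nonneg δ)]

lemma skFree_le (n : ℕ) (β : ℝ) : skFree n β ≤ n * Real.log 2 + n * β ^ 2 / 4 := by
  have h : IsGaussField (Measure.dirac (0 : (Fin n → Bool) → ℝ)) fun _ _ => 0 :=
    .of_isGaussian (fun a => by simp) fun a b => by simp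
  have h' := isGaussField_sk (n := n) β id
  have key := h.integral_lse_sub_le h' (K := n * β ^ 2 / 2) (L := 0) (fun a => ?_) fun a b => ?_
  · rw [integral_map (LinearMap.continuous_of_finiteDimensional _).measurable.aemeasurable
      measurable_lse.aestronglyMeasurable, integral_dirac, lse_zero_bool] at key
    have : ∀ g, lse (boltzLin β (id : (Fin n → Bool) → _) g) = lse (boltz β g) := fun g => rfl
    simp_rw [this] at key
    unfold skFree
    linarith
  · simp only [dotSpin_self, id]
    rcases eq_or_ne (n : ℝ) 0 with h | h
    · simp [h]
    · refine le_of_eq ?_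
      field_simp
      ring
  · have : 0 ≤ β ^ 2 * (1 / (2 * (n : ℝ)) * dotSpin (id a) (id b) ^ 2) := by positivity
    linarith

/-- The limiting SK free energy per site. -/
theorem exists_tendsto_skFree (β : ℝ) :
    ∃ p, Tendsto (fun n : ℕ => skFree n β / n) atTop (nhds p) := by
  have hsub : Subadditive fun n => -skFree n β := fun m n => by
    have := skFree_superadditive m n β
    linarith
  have hb : BddBelow (Set.range fun n : ℕ => -skFree n β / n) := by
    refine ⟨-(Real.log 2 + β ^ 2 / 4), ?_⟩
    rintro _ ⟨n, rfl⟩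
    dsimp only
    rcases Nat.eq_zero_or_pos n with rfl | hn
    · simp only [Nat.cast_zero, div_zero]
      have := Real.log_nonneg (show (1 : ℝ) ≤ 2 by norm_num)
      nlinarith [sq_nonneg β]
    have hn' : (0 : ℝ) < n := by exact_mod_cast hn
    rw [le_div_iff₀ hn']
    have := skFree_le n β
    linarith
  refine ⟨-hsub.lim, ?_⟩
  have := (hsub.tendsto_lim hb).neg
  simpa [neg_div] using this

end SKFreeEnergy

section Gauge

lemma lse_mono {ι : Type*} [Fintype ι] [Nonempty ι] {w w' : ι → ℝ} (h : ∀ a, w a ≤ w' a) :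
    lse w ≤ lse w' :=
  Real.log_le_log (sum_exp_pos w) (Finset.sum_le_sum fun a _ => Real.exp_le_exp.2 (h a))

lemma measurable_softmax {ι : Type*} [Fintype ι] (a : ι) :
    Measurable fun w : ι → ℝ => softmax w a := by
  unfold softmax
  fun_prop

/-- Flipping the spin at site `i`. -/
def flipAt {n : ℕ} (i : Fin n) (σ : Fin n → Bool) : Fin n → Bool := Function.update σ i (!σ i)

lemma flipAt_involutive {n : ℕ} (i : Fin n) : Function.Involutive (flipAt i) := fun σ => by
  simp [flipAt]

/-- The sign by which `flipAt i` multiplies the spin at site `a`. -/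
noncomputable def flipSign {n : ℕ} (i a : Fin n) : ℝ := if a = i then -1 else 1

lemma spin_flipAt {n : ℕ} (i a : Fin n) (σ : Fin n → Bool) :
    spin (flipAt i σ a) = flipSign i a * spin (σ a) := by
  by_cases h : a = i
  · subst h
    cases h' : σ a <;> simp [flipAt, flipSign, spin, h']
  · simp [flipAt, flipSign, h]

/-- The gauge transformation of the disorder associated with `flipAt i`. -/
noncomputable def gaugeFlip {n : ℕ} (i : Fin n) (g : Fin n → Fin n → ℝ) : Fin n → Fin n → ℝ :=
  fun a b => flipSign i a * flipSign i b * g a b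

lemma Ham_gauge {n : ℕ} (i : Fin n) (g : Fin n → Fin n → ℝ) (σ : Fin n → Bool) :
    Ham (gaugeFlip i g) σ = Ham g (flipAt i σ) := by
  simp only [Ham, gaugeFlip, spin_flipAt]
  exact Finset.sum_congr rfl fun a _ => Finset.sum_congr rfl fun b _ => by ring

lemma measurePreserving_gauge {n : ℕ} (i : Fin n) :
    MeasurePreserving (gaugeFlip i) (skMeasure n) (skMeasure n) := by
  have h0 : ∀ a b : Fin n, (gaussianReal 0 (1 / (2 * n))).map
      (fun y => flipSign i a * flipSign i b * y) = gaussianReal 0 (1 / (2 * n)) := by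
    intro a b
    have hs : flipSign i a * flipSign i b = 1 ∨ flipSign i a * flipSign i b = -1 := by
      unfold flipSign; split_ifs <;> simp
    rcases hs with h | h
    · simp [h]
    · simp [h, gaussianReal_map_neg]
  have h1 : ∀ a : Fin n, (Measure.pi fun _ : Fin n => gaussianReal 0 (1 / (2 * n))).map
      (fun r b => flipSign i a * flipSign i b * r b)
      = Measure.pi fun _ : Fin n => gaussianReal 0 (1 / (2 * n)) := by
    intro a
    have (b : Fin n) : SigmaFinite ((gaussianReal 0 (1 / (2 * n))).map
        (fun y => flipSign i a * flipSign i b * y)) := by rw [h0]; infer_instance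
    rw [Measure.pi_map_pi (f := fun b y => flipSign i a * flipSign i b * y)
      (fun b => by fun_prop)]
    simp_rw [h0]
  have hm : Measurable (gaugeFlip i) := by unfold gaugeFlip; fun_prop
  refine ⟨hm, ?_⟩
  have (a : Fin n) : SigmaFinite ((Measure.pi fun _ : Fin n => gaussianReal 0 (1 / (2 * n))).map
      (fun r b => flipSign i a * flipSign i b * r b)) := by rw [h1]; infer_instance
  have h2 := Measure.pi_map_pi
    (μ := fun _ : Fin n => Measure.pi fun _ : Fin n => gaussianReal 0 (1 / (2 * n)))
    (f := fun a r b => flipSign i a * flipSign i b * r b)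
    (fun a => Measurable.aemeasurable (by fun_prop))
  simp_rw [h1] at h2
  exact h2

lemma softmax_gauge {n : ℕ} (β : ℝ) (i : Fin n) (g : Fin n → Fin n → ℝ) (σ : Fin n → Bool) :
    softmax (boltz β (gaugeFlip i g)) σ = softmax (boltz β g) (flipAt i σ) := by
  unfold softmax boltz
  simp_rw [Ham_gauge]
  rw [(flipAt_involutive i).bijective.sum_comp fun τ => Real.exp (-β * Ham g τ)]

lemma integrable_sum_softmax {n : ℕ} (β : ℝ) (x : (Fin n → Bool) → ℝ) :
    Integrable (fun g => ∑ σ, softmax (boltz β g) σ * x σ) (skMeasure n) := by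
  refine Integrable.of_bound (C := ∑ σ, |x σ|) (Measurable.aestronglyMeasurable ?_)
    (ae_of_all _ fun g => ?_)
  · exact Finset.measurable_sum _ fun σ _ =>
      ((measurable_softmax σ).comp (measurable_boltz β)).mul_const _
  · exact abs_sum_softmax_mul_le _ _ fun σ =>
      Finset.single_le_sum (f := fun σ => |x σ|) (fun _ _ => abs_nonneg _) (Finset.mem_univ σ)

lemma integral_spin_mul_spin {n : ℕ} (β : ℝ) {i j : Fin n} (hij : i ≠ j) :
    ∫ g, ∑ σ, softmax (boltz β g) σ * (spin (σ i) * spin (σ j)) ∂skMeasure n = 0 := by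
  set φ : (Fin n → Fin n → ℝ) → ℝ :=
    fun g => ∑ σ, softmax (boltz β g) σ * (spin (σ i) * spin (σ j)) with hφ
  have h1 : ∀ g, φ (gaugeFlip i g) = -φ g := by
    intro g
    simp only [hφ, softmax_gauge]
    rw [← (flipAt_involutive i).bijective.sum_comp fun σ =>
      softmax (boltz β g) σ * (spin (σ i) * spin (σ j)), ← Finset.sum_neg_distrib]
    refine Finset.sum_congr rfl fun σ _ => ?_
    rw [spin_flipAt, spin_flipAt]
    simp [flipSign, hij.symm]
  have h2 : ∫ g, φ (gaugeFlip i g) ∂skMeasure n = ∫ g, φ g ∂skMeasure n := by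
    conv_rhs => rw [← (measurePreserving_gauge i).map_eq]
    rw [integral_map (measurePreserving_gauge i).measurable.aemeasurable]
    rw [(measurePreserving_gauge i).map_eq]
    exact (integrable_sum_softmax β _).aestronglyMeasurable
  simp_rw [h1, integral_neg] at h2
  linarith

lemma integral_magnetization_sq {n : ℕ} (β : ℝ) :
    ∫ g, ∑ σ, softmax (boltz β g) σ * (∑ i, spin (σ i)) ^ 2 ∂skMeasure n = n := by
  have h : ∀ g : Fin n → Fin n → ℝ, ∑ σ, softmax (boltz β g) σ * (∑ i, spin (σ i)) ^ 2
      = ∑ i, ∑ j, ∑ σ, softmax (boltz β g) σ * (spin (σ i) * spin (σ j)) := by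
    intro g
    simp_rw [sq, Finset.sum_mul_sum, Finset.mul_sum]
    rw [Finset.sum_comm]
    exact Finset.sum_congr rfl fun i _ => Finset.sum_comm
  simp_rw [h]
  rw [integral_finsetSum _ fun i _ => integrable_finsetSum _ fun j _ => integrable_sum_softmax β _]
  have h2 : ∀ i : Fin n, ∫ g, ∑ j, ∑ σ, softmax (boltz β g) σ * (spin (σ i) * spin (σ j))
      ∂skMeasure n = 1 := by
    intro i
    rw [integral_finsetSum _ fun j _ => integrable_sum_softmax β _, Finset.sum_eq_single i]
    · simp [spin_mul_self, sum_softmax]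
    · exact fun j _ hj => integral_spin_mul_spin β hj.symm
    · simp
  simp [h2]

lemma boltz_const {n : ℕ} (β m : ℝ) (σ : Fin n → Bool) :
    boltz β (fun _ _ => m) σ = -(β * m) * (∑ i, spin (σ i)) ^ 2 := by
  rw [boltz, Ham, sq, Finset.sum_mul_sum]
  simp only [Finset.mul_sum]
  exact Finset.sum_congr rfl fun i _ => Finset.sum_congr rfl fun j _ => by ring

/-- A mean shift of the SK disorder changes the free energy by at most `β m n`. -/
theorem abs_integral_lse_shift_sub_le {n : ℕ} {β m : ℝ} (hβ : 0 ≤ β) (hm : 0 ≤ m) :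
    |skFree n β - ∫ g, lse (boltz β (g + fun _ _ => m)) ∂skMeasure n| ≤ β * m * n := by
  have hc : 0 ≤ β * m := mul_nonneg hβ hm
  have hs : ∀ g : Fin n → Fin n → ℝ, boltz β (g + fun _ _ => m)
      = boltz β g + fun σ => -(β * m) * (∑ i, spin (σ i)) ^ 2 := fun g => funext fun σ => by
    rw [boltz_add, boltz_const, Pi.add_apply]
  have hle : ∀ g : Fin n → Fin n → ℝ, lse (boltz β (g + fun _ _ => m)) ≤ lse (boltz β g) :=
    fun g => lse_mono fun σ => by
      rw [hs, Pi.add_apply]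
      have := mul_nonneg hc (sq_nonneg (∑ i, spin (σ i)))
      linarith
  have hge : ∀ g : Fin n → Fin n → ℝ, lse (boltz β g)
      - β * m * ∑ σ, softmax (boltz β g) σ * (∑ i, spin (σ i)) ^ 2
      ≤ lse (boltz β (g + fun _ _ => m)) := fun g => by
    have := lse_add_ge (boltz β g) fun σ => -(β * m) * (∑ i, spin (σ i)) ^ 2
    rw [hs]
    refine le_trans (le_of_eq ?_) this
    rw [Finset.mul_sum, sub_eq_add_neg, ← Finset.sum_neg_distrib]
    congr 1
    exact Finset.sum_congr rfl fun σ _ => by ring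
  have hI := integrable_lse_boltz_skMeasure n β
  have hM := (integrable_sum_softmax (n := n) β fun σ => (∑ i, spin (σ i)) ^ 2).const_mul (β * m)
  have hmeas : Measurable fun g : Fin n → Fin n → ℝ => lse (boltz β (g + fun _ _ => m)) :=
    measurable_lse.comp ((measurable_boltz β).comp (by fun_prop))
  have hJ : Integrable (fun g => lse (boltz β (g + fun _ _ => m))) (skMeasure n) :=
    integrable_of_le_of_le hmeas.aestronglyMeasurable (ae_of_all _ hge) (ae_of_all _ hle)
      (hI.sub hM) hI
  have h1 := integral_mono hJ hI hle
  have h2 := integral_mono (hI.sub hM) hJ hge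
  simp only [Pi.sub_apply] at h2
  rw [integral_sub hI hM, integral_const_mul, integral_magnetization_sq] at h2
  rw [skFree, abs_le]
  constructor <;> nlinarith [mul_nonneg hc (Nat.cast_nonneg (α := ℝ) n)]

end Gauge

section Poisson

open scoped NNReal Nat

private lemma hasSum_poisson_shift {r : ℝ≥0} {f : ℕ → ℝ} {s : ℝ}
    (h : HasSum (fun k => Real.exp (-r) * r ^ k / k ! * f k) s) :
    HasSum (fun k => Real.exp (-r) * r ^ k / k ! * (k * f (k - 1))) (r * s) := by
  rw [← hasSum_nat_add_iff' 1]
  simp only [Finset.range_one, Finset.sum_singleton, Nat.cast_zero, zero_mul, mul_zero, sub_zero]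
  refine (h.mul_left (r : ℝ)).congr_fun fun k => ?_
  rw [Nat.factorial_succ, pow_succ, Nat.add_sub_cancel]
  push_cast
  field_simp

private lemma integrable_and_integral_poisson {r : ℝ≥0} {f : ℕ → ℝ} (hf : ∀ k, 0 ≤ f k) {s : ℝ}
    (h : HasSum (fun k => Real.exp (-r) * r ^ k / k ! * f k) s) :
    Integrable f (poissonMeasure r) ∧ ∫ k, f k ∂poissonMeasure r = s := by
  refine ⟨integrable_poissonMeasure_iff.2 ?_, ?_⟩
  · simpa only [Real.norm_of_nonneg (hf _)] using h.summable
  · rw [integral_poissonMeasure]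
    simpa only [smul_eq_mul] using h.tsum_eq

private lemma hasSum_poisson_id (r : ℝ≥0) :
    HasSum (fun k : ℕ => Real.exp (-r) * r ^ k / k ! * (k : ℝ)) r := by
  have h := hasSum_poisson_shift (r := r) (f := fun _ => 1) (s := 1)
    (by simpa using hasSum_one_poissonMeasure r)
  simpa using h

private lemma hasSum_poisson_sq (r : ℝ≥0) :
    HasSum (fun k : ℕ => Real.exp (-r) * r ^ k / k ! * (k : ℝ) ^ 2) (r ^ 2 + r) := by
  have h := hasSum_poisson_shift (f := fun k => (k : ℝ) + 1) (s := r + 1) (r := r) (by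
    simpa [mul_add] using (hasSum_poisson_id r).add (hasSum_one_poissonMeasure r))
  convert h using 1
  · funext k
    cases k <;> simp [sq]
  · ring

private lemma hasSum_poisson_cube (r : ℝ≥0) :
    HasSum (fun k : ℕ => Real.exp (-r) * r ^ k / k ! * (k : ℝ) ^ 3) (r ^ 3 + 3 * r ^ 2 + r) := by
  have h := hasSum_poisson_shift (f := fun k => ((k : ℝ) + 1) ^ 2) (s := (r ^ 2 + r) + 2 * r + 1)
    (r := r) (by
      refine (((hasSum_poisson_sq r).add ((hasSum_poisson_id r).mul_left 2)).add
        (hasSum_one_poissonMeasure r)).congr_fun fun k => ?_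
      ring)
  convert h using 1
  · funext k
    cases k <;> simp [pow_succ]; ring_nf; simp
  · ring

lemma integrable_poisson (r : ℝ≥0) : Integrable (fun k : ℕ => (k : ℝ)) (poissonMeasure r) :=
  (integrable_and_integral_poisson (fun k => by positivity) (hasSum_poisson_id r)).1

lemma integral_poisson (r : ℝ≥0) : ∫ k : ℕ, (k : ℝ) ∂poissonMeasure r = r :=
  (integrable_and_integral_poisson (fun k => by positivity) (hasSum_poisson_id r)).2

lemma integral_sub_sq_poisson (r : ℝ≥0) :
    ∫ k : ℕ, ((k : ℝ) - r) ^ 2 ∂poissonMeasure r = r := by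
  obtain ⟨i2, h2⟩ := integrable_and_integral_poisson (fun k => by positivity) (hasSum_poisson_sq r)
  have he : ∀ k : ℕ, ((k : ℝ) - r) ^ 2 = (k : ℝ) ^ 2 - 2 * r * k + r ^ 2 := fun k => by ring
  have i1 : Integrable (fun k : ℕ => 2 * (r : ℝ) * k) (poissonMeasure r) :=
    (integrable_poisson r).const_mul _
  have i3 : Integrable (fun k : ℕ => (k : ℝ) ^ 2 - 2 * (r : ℝ) * k) (poissonMeasure r) := i2.sub i1
  simp_rw [he]
  rw [integral_add i3 (integrable_const _), integral_sub i2 i1, h2, integral_const_mul,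
    integral_poisson, integral_const, probReal_univ, one_smul]
  ring

private lemma abs_sub_cube_le {x y : ℝ} (hx : 0 ≤ x) (hy : 0 ≤ y) :
    |x - y| ^ 3 ≤ x ^ 3 + y ^ 3 := by
  rcases le_total x y with h | h
  · rw [abs_of_nonpos (by linarith)]
    have := pow_le_pow_left₀ (by linarith) (by linarith : -(x - y) ≤ y) 3
    have := pow_nonneg hx 3
    linarith
  · rw [abs_of_nonneg (by linarith)]
    have := pow_le_pow_left₀ (by linarith) (by linarith : x - y ≤ x) 3
    have := pow_nonneg hy 3
    linarith

lemma integrable_abs_sub_cube_poisson (r : ℝ≥0) :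
    Integrable (fun k : ℕ => |(k : ℝ) - r| ^ 3) (poissonMeasure r) := by
  obtain ⟨i3, -⟩ := integrable_and_integral_poisson (fun k => by positivity) (hasSum_poisson_cube r)
  refine (i3.add (integrable_const ((r : ℝ) ^ 3))).mono' .of_discrete (ae_of_all _ fun k => ?_)
  rw [Real.norm_of_nonneg (by positivity)]
  exact abs_sub_cube_le (by positivity) r.2

lemma integral_abs_sub_cube_poisson_le (r : ℝ≥0) :
    ∫ k : ℕ, |(k : ℝ) - r| ^ 3 ∂poissonMeasure r ≤ 2 * r ^ 3 + 3 * r ^ 2 + r := by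
  obtain ⟨i3, h3⟩ := integrable_and_integral_poisson (fun k => by positivity)
    (hasSum_poisson_cube r)
  have hle : ∫ k : ℕ, |(k : ℝ) - r| ^ 3 ∂poissonMeasure r
      ≤ ∫ k : ℕ, ((k : ℝ) ^ 3 + (r : ℝ) ^ 3) ∂poissonMeasure r :=
    integral_mono (integrable_abs_sub_cube_poisson r) (i3.add (integrable_const _))
      fun k => abs_sub_cube_le (Nat.cast_nonneg k) r.2
  rw [integral_add i3 (integrable_const _), h3, integral_const, probReal_univ, one_smul] at hle
  linarith

end Poisson

section Transfer

/-- Entrywise pushforward of a matrix with independent identically distributed entries. -/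
lemma measurePreserving_matrix_map {E F : Type*} [MeasurableSpace E] [MeasurableSpace F] (n : ℕ)
    (μ : Measure E) [IsProbabilityMeasure μ] {f : E → F} (hf : Measurable f) :
    MeasurePreserving (fun (X : Fin n → Fin n → E) i j => f (X i j))
      (Measure.pi fun _ => Measure.pi fun _ => μ)
      (Measure.pi fun _ => Measure.pi fun _ => μ.map f) := by
  have : IsProbabilityMeasure (μ.map f) := Measure.isProbabilityMeasure_map hf.aemeasurable
  exact measurePreserving_pi _ _ fun _ => measurePreserving_pi _ _ fun _ => hf.measurePreserving μ

end Transfer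

/-- The expected log-partition function of the rescaled sparse model. -/
noncomputable def sparseFree (n : ℕ) (d β : ℝ) : ℝ :=
  ∫ A, lse (boltz (β / Real.sqrt d) (natMat A)) ∂sparseMeasure n d

lemma boltz_natMat {n : ℕ} (β s : ℝ) (A : Fin n → Fin n → ℕ) :
    boltz (β / s) (natMat A) = boltz β (fun i j => (A i j : ℝ) / s) := by
  funext σ
  simp only [boltz, Ham, natMat, Finset.mul_sum]
  exact Finset.sum_congr rfl fun i _ => Finset.sum_congr rfl fun j _ => by ring

lemma sparseFree_eq (n : ℕ) (d β : ℝ) :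
    sparseFree n d β = ∫ X : Fin n → Fin n → ℝ, lse (boltz β X) ∂(Measure.pi fun _ =>
      Measure.pi fun _ => (poissonMeasure (d / (2 * n)).toNNReal).map
        fun k : ℕ => (k : ℝ) / Real.sqrt d) := by
  have hp := measurePreserving_matrix_map n (poissonMeasure (d / (2 * n)).toNNReal)
    (f := fun k : ℕ => (k : ℝ) / Real.sqrt d) .of_discrete
  rw [← hp.map_eq, integral_map (f := fun X => lse (boltz β X)) hp.measurable.aemeasurable
    (measurable_lse.comp (measurable_boltz β)).aestronglyMeasurable]
  simp_rw [sparseFree, boltz_natMat]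
  rfl

lemma integral_lse_shift_eq (n : ℕ) (β m : ℝ) :
    ∫ g, lse (boltz β (g + fun _ _ => m)) ∂skMeasure n
      = ∫ X : Fin n → Fin n → ℝ, lse (boltz β X) ∂(Measure.pi fun _ =>
      Measure.pi fun _ => (gaussianReal 0 (1 / (2 * n))).map fun y => y + m) := by
  have hp := measurePreserving_matrix_map n (gaussianReal 0 (1 / (2 * n)))
    (f := fun y => y + m) (by fun_prop)
  rw [← hp.map_eq, integral_map (f := fun X => lse (boltz β X)) hp.measurable.aemeasurable
    (measurable_lse.comp (measurable_boltz β)).aestronglyMeasurable]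
  rfl

lemma integrable_abs_cube_gaussianReal (v : NNReal) :
    Integrable (fun y => |y| ^ 3) (gaussianReal 0 v) := by
  simpa using (memLp_id_gaussianReal (μ := 0) (v := v) 3).integrable_norm_pow (by norm_num)

lemma integral_abs_cube_gaussianReal (v : NNReal) :
    ∫ y, |y| ^ 3 ∂gaussianReal 0 v = Real.sqrt v ^ 3 * ∫ y, |y| ^ 3 ∂gaussianReal 0 1 := by
  have h : gaussianReal 0 v = (gaussianReal 0 1).map (Real.sqrt v * ·) := by
    rw [gaussianReal_map_const_mul]
    congr 1
    · simp
    · ext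
      simp
  rw [h, integral_map (f := fun y => |y| ^ 3) (by fun_prop) (by fun_prop)]
  simp_rw [abs_mul, mul_pow, integral_const_mul, abs_of_nonneg (Real.sqrt_nonneg _)]

/-- Quantitative comparison of the two free energies. -/
theorem abs_skFree_sub_sparseFree_le {n : ℕ} {β d : ℝ} (hβ : 0 ≤ β) (hd : 1 ≤ d) (hn : d ≤ n) :
    |skFree n β - sparseFree n d β| / n ≤ 9 * β ^ 3 / Real.sqrt d
      + 3 * β ^ 3 * (∫ y, |y| ^ 3 ∂gaussianReal 0 1) * Real.sqrt (1 / (2 * n))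
      + β * Real.sqrt d / (2 * n) := by
  have hd0 : 0 < d := by linarith
  have hn0 : (0 : ℝ) < n := by linarith
  set s := Real.sqrt d with hs
  have hs0 : 0 < s := Real.sqrt_pos.2 hd0
  have hss : s * s = d := Real.mul_self_sqrt hd0.le
  set r : NNReal := (d / (2 * n)).toNNReal with hr
  have hrv : (r : ℝ) = d / (2 * n) := Real.coe_toNNReal _ (by positivity)
  set m : ℝ := r / s with hm
  have hm0 : 0 ≤ m := by positivity
  set v : NNReal := 1 / (2 * n) with hv
  have hvv : (v : ℝ) = 1 / (2 * n) := by simp [hv]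
  have hrs : (r : ℝ) / s ^ 2 = v := by
    rw [hrv, hvv, sq, hss]
    field_simp
  set μ := (poissonMeasure r).map fun k : ℕ => (k : ℝ) / s with hμ
  set ν := (gaussianReal 0 v).map fun y => y + m with hν
  have hfm : Measurable fun k : ℕ => (k : ℝ) / s := .of_discrete
  have hgm : Measurable fun y : ℝ => y + m := by fun_prop
  have : IsProbabilityMeasure μ := Measure.isProbabilityMeasure_map hfm.aemeasurable
  have : IsProbabilityMeasure ν := Measure.isProbabilityMeasure_map hgm.aemeasurable
  have hsub : ∀ k : ℕ, (k : ℝ) / s - m = ((k : ℝ) - r) / s := fun k => by rw [hm]; ring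
  have hcube : ∀ k : ℕ, |(k : ℝ) / s - m| ^ 3 = |(k : ℝ) - r| ^ 3 / s ^ 3 := fun k => by
    rw [hsub, abs_div, div_pow, abs_of_pos hs0]
  have hμi : Integrable (fun y => |y|) μ := by
    rw [hμ, integrable_map_measure (by fun_prop) hfm.aemeasurable]
    exact ((integrable_poisson r).div_const s).abs
  have hidg : Integrable (fun y : ℝ => y) (gaussianReal 0 v) :=
    (memLp_id_gaussianReal (μ := 0) (v := v) 1).integrable (by norm_num)
  have hνi : Integrable (fun y => |y|) ν := by
    rw [hν, integrable_map_measure (by fun_prop) hgm.aemeasurable]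
    exact (hidg.add (integrable_const m)).abs
  have hμ3 : Integrable (fun y => |y - m| ^ 3) μ := by
    rw [hμ, integrable_map_measure (by fun_prop) hfm.aemeasurable]
    refine ((integrable_abs_sub_cube_poisson r).div_const (s ^ 3)).congr (ae_of_all _ fun k => ?_)
    exact (hcube k).symm
  have hν3 : Integrable (fun y => |y - m| ^ 3) ν := by
    rw [hν, integrable_map_measure (by fun_prop) hgm.aemeasurable]
    refine (integrable_abs_cube_gaussianReal v).congr (ae_of_all _ fun k => ?_)
    simp
  have hμ1 : ∫ y, (y - m) ∂μ = 0 := by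
    rw [hμ, integral_map hfm.aemeasurable (by fun_prop)]
    simp_rw [hsub, integral_div]
    rw [integral_sub (integrable_poisson r) (integrable_const _), integral_poisson]
    simp
  have hν1 : ∫ y, (y - m) ∂ν = 0 := by
    rw [hν, integral_map hgm.aemeasurable (by fun_prop)]
    simp
  have hμ2 : ∫ y, (y - m) ^ 2 ∂μ = v := by
    rw [hμ, integral_map hfm.aemeasurable (by fun_prop)]
    simp_rw [hsub, div_pow, integral_div]
    rw [integral_sub_sq_poisson, hrs]
  have hν2 : ∫ y, (y - m) ^ 2 ∂ν = v := by
    rw [hν, integral_map hgm.aemeasurable (by fun_prop)]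
    simpa [sq] using integral_sq_gaussianReal v
  have hμ3' : ∫ y, |y - m| ^ 3 ∂μ ≤ 3 * v / s := by
    rw [hμ, integral_map hfm.aemeasurable (by fun_prop)]
    simp_rw [hcube, integral_div]
    have h1 := integral_abs_sub_cube_poisson_le r
    have hr0 : (0 : ℝ) ≤ r := r.2
    have hr1 : (r : ℝ) ≤ 1 / 2 := by
      rw [hrv, div_le_iff₀ (by positivity)]
      linarith
    have h2 : 2 * (r : ℝ) ^ 3 + 3 * r ^ 2 + r ≤ 3 * r := by
      nlinarith [mul_nonneg hr0 (sub_nonneg.2 hr1), mul_nonneg (mul_nonneg hr0 hr0)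
        (sub_nonneg.2 hr1)]
    calc _ ≤ 3 * (r : ℝ) / s ^ 3 := by gcongr; linarith
      _ = 3 * v / s := by rw [← hrs]; field_simp
  have hν3' : ∫ y, |y - m| ^ 3 ∂ν = Real.sqrt v ^ 3 * ∫ y, |y| ^ 3 ∂gaussianReal 0 1 := by
    rw [hν, integral_map hgm.aemeasurable (by fun_prop), ← integral_abs_cube_gaussianReal]
    simp
  set c := ∫ y, |y| ^ 3 ∂gaussianReal 0 1 with hc
  have key := abs_integral_lse_boltz_sub_le (n := n) β hμi hνi hμ3 hν3 hμ1 hν1 hμ2 hν2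
  have hshift := abs_integral_lse_shift_sub_le (n := n) hβ hm0
  rw [integral_lse_shift_eq] at hshift
  have hsf := sparseFree_eq n d β
  rw [← hs, ← hr, ← hμ] at hsf
  rw [← hν] at hshift
  rw [← hsf, hν3', abs_of_nonneg hβ] at key
  have hsv : Real.sqrt v ^ 3 = v * Real.sqrt v := by
    rw [pow_succ, Real.sq_sqrt (NNReal.coe_nonneg v)]
  have htri : |skFree n β - sparseFree n d β| ≤
      n * (n * (6 * β ^ 3 * (3 * v / s + v * Real.sqrt v * c))) + β * m * n := by
    have h3 : (n : ℝ) * (n * (6 * β ^ 3 * (∫ y, |y - m| ^ 3 ∂μ + Real.sqrt v ^ 3 * c)))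
        ≤ n * (n * (6 * β ^ 3 * (3 * v / s + v * Real.sqrt v * c))) := by
      rw [hsv]
      gcongr
    rw [abs_sub_le_iff] at *
    constructor <;> linarith
  have hmv : m = s * v := by
    rw [hm, ← hrs]
    field_simp
  rw [div_le_iff₀ hn0]
  refine htri.trans (le_of_eq ?_)
  rw [hmv, ← hvv]
  generalize Real.sqrt v = w
  rw [hvv]
  field_simp
  ring

section Energy

lemma avg1_eq_sum_softmax {n : ℕ} (β : ℝ) (X : Fin n → Fin n → ℝ) (f : (Fin n → Bool) → ℝ) :
    avg1 β X f = ∑ σ, softmax (boltz β X) σ * f σ :=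
  Finset.sum_congr rfl fun _ _ => mul_comm _ _

lemma abs_avg1_Ham_le {n : ℕ} (β : ℝ) (X : Fin n → Fin n → ℝ) :
    |avg1 β X (Ham X)| ≤ ∑ i, ∑ j, |X i j| := by
  rw [avg1_eq_sum_softmax]
  exact abs_sum_softmax_mul_le _ _ (abs_Ham_le X)

lemma measurable_avg1_Ham {n : ℕ} (β : ℝ) :
    Measurable fun X : Fin n → Fin n → ℝ => avg1 β X (Ham X) := by
  simp_rw [avg1_eq_sum_softmax]
  exact Finset.measurable_sum _ fun σ _ =>
    ((measurable_softmax σ).comp (measurable_boltz β)).mul (measurable_Ham σ)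

/-- The mean energy is a subgradient of the convex free energy. -/
lemma integral_avg1_Ham_subgradient {Ω : Type*} [MeasurableSpace Ω] {P : Measure Ω}
    [IsProbabilityMeasure P] {n : ℕ} {X : Ω → Fin n → Fin n → ℝ} (hX : Measurable X)
    (hi : ∀ i j, Integrable (fun ω => X ω i j) P) (β β' : ℝ) :
    -(β' - β) * ∫ ω, avg1 β (X ω) (Ham (X ω)) ∂P
      ≤ ∫ ω, lse (boltz β' (X ω)) ∂P - ∫ ω, lse (boltz β (X ω)) ∂P := by
  have hs : Integrable (fun ω => ∑ i, ∑ j, |X ω i j|) P :=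
    integrable_finsetSum _ fun i _ => integrable_finsetSum _ fun j _ => (hi i j).abs
  have hl : ∀ b : ℝ, Integrable (fun ω => lse (boltz b (X ω))) P := by
    intro b
    refine ((integrable_const |lse (0 : (Fin n → Bool) → ℝ)|).add (hs.const_mul |b|)).mono'
      ((measurable_lse.comp (measurable_boltz b)).comp hX).aestronglyMeasurable
      (ae_of_all _ fun ω => ?_)
    simpa [Finset.mul_sum] using abs_lse_boltz_le b (X ω)
  have ha : Integrable (fun ω => avg1 β (X ω) (Ham (X ω))) P :=
    hs.mono' ((measurable_avg1_Ham β).comp hX).aestronglyMeasurable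
      (ae_of_all _ fun ω => abs_avg1_Ham_le β (X ω))
  rw [← integral_sub (hl β') (hl β), ← integral_const_mul]
  refine integral_mono (ha.const_mul _) ((hl β').sub (hl β)) fun ω => ?_
  have h := lse_add_ge (boltz β (X ω)) fun σ => -(β' - β) * Ham (X ω) σ
  have e1 : (boltz β (X ω) + fun σ => -(β' - β) * Ham (X ω) σ) = boltz β' (X ω) := by
    funext σ
    simp only [boltz, Pi.add_apply]
    ring
  have e2 : ∑ σ, softmax (boltz β (X ω)) σ * (-(β' - β) * Ham (X ω) σ)
      = -(β' - β) * avg1 β (X ω) (Ham (X ω)) := by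
    rw [avg1_eq_sum_softmax, Finset.mul_sum]
    exact Finset.sum_congr rfl fun σ _ => by ring
  rw [e1, e2] at h
  simp only
  linarith

lemma integrable_entry_skMeasure {n : ℕ} (i j : Fin n) :
    Integrable (fun g : Fin n → Fin n → ℝ => g i j) (skMeasure n) := by
  have h := IsGaussian.memLp_id (skMeasure n) 1 (by norm_num)
  exact ((h.eval i).eval j).integrable le_rfl

instance (n : ℕ) (d : ℝ) : IsProbabilityMeasure (sparseMeasure n d) := by
  unfold sparseMeasure
  infer_instance

lemma measurable_natMat {n : ℕ} : Measurable (natMat (n := n)) :=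
  measurable_pi_lambda _ fun i => measurable_pi_lambda _ fun j =>
    (Measurable.of_discrete (f := fun k : ℕ => (k : ℝ))).comp
      ((measurable_pi_apply j).comp (measurable_pi_apply i))

lemma measurePreserving_entry_sparseMeasure {n : ℕ} (d : ℝ) (i j : Fin n) :
    MeasurePreserving (fun A : Fin n → Fin n → ℕ => A i j) (sparseMeasure n d)
      (poissonMeasure (d / (2 * n)).toNNReal) :=
  (measurePreserving_eval (fun _ : Fin n => poissonMeasure (d / (2 * n)).toNNReal) j).comp
    (measurePreserving_eval
      (fun _ : Fin n => Measure.pi fun _ : Fin n => poissonMeasure (d / (2 * n)).toNNReal) i)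

lemma integrable_entry_sparseMeasure {n : ℕ} (d : ℝ) (i j : Fin n) :
    Integrable (fun A : Fin n → Fin n → ℕ => natMat A i j) (sparseMeasure n d) :=
  (measurePreserving_entry_sparseMeasure d i j).integrable_comp_of_integrable
    (integrable_poisson _)

lemma integral_entry_sparseMeasure {n : ℕ} {d : ℝ} (hd : 0 ≤ d) (i j : Fin n) :
    ∫ A : Fin n → Fin n → ℕ, natMat A i j ∂sparseMeasure n d = d / (2 * n) := by
  have hp := measurePreserving_entry_sparseMeasure d i j
  have h := integral_map (μ := sparseMeasure n d) (f := fun k : ℕ => (k : ℝ))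
    hp.measurable.aemeasurable .of_discrete
  rw [hp.map_eq, integral_poisson, Real.coe_toNNReal _ (by positivity)] at h
  exact h.symm

/-- The expected energy of the SK model. -/
noncomputable def skEnergy (n : ℕ) (β : ℝ) : ℝ :=
  ∫ g, avg1 β g (Ham g) ∂skMeasure n

/-- The expected energy of the rescaled sparse model. -/
noncomputable def sparseEnergy (n : ℕ) (d β : ℝ) : ℝ :=
  1 / Real.sqrt d * ∫ A, avg1 (β / Real.sqrt d) (natMat A) (Ham (natMat A)) ∂sparseMeasure n d

lemma skEnergy_subgradient (n : ℕ) (β δ : ℝ) :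
    -δ * skEnergy n β ≤ skFree n (β + δ) - skFree n β := by
  have h := integral_avg1_Ham_subgradient (P := skMeasure n) measurable_id
    integrable_entry_skMeasure β (β + δ)
  simpa [skFree, skEnergy] using h

lemma sparseEnergy_subgradient (n : ℕ) (d β δ : ℝ) :
    -δ * sparseEnergy n d β ≤ sparseFree n d (β + δ) - sparseFree n d β := by
  have h := integral_avg1_Ham_subgradient (P := sparseMeasure n d) measurable_natMat
    (integrable_entry_sparseMeasure d) (β / Real.sqrt d) ((β + δ) / Real.sqrt d)
  refine le_trans (le_of_eq ?_) h
  rw [sparseEnergy]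
  ring

lemma abs_skEnergy_sub_sparseEnergy_le (n : ℕ) (d β : ℝ) {δ : ℝ} (hδ : 0 < δ) :
    |skEnergy n β - sparseEnergy n d β| ≤
      (skFree n (β + δ) + skFree n (β - δ) - 2 * skFree n β
        + |skFree n (β + δ) - sparseFree n d (β + δ)|
        + |skFree n (β - δ) - sparseFree n d (β - δ)|
        + |skFree n β - sparseFree n d β|) / δ := by
  have h1 := skEnergy_subgradient n β δ
  have h2 := skEnergy_subgradient n β (-δ)
  have h3 := sparseEnergy_subgradient n d β δ
  have h4 := sparseEnergy_subgradient n d β (-δ)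
  rw [← sub_eq_add_neg] at h2 h4
  have a1 := neg_abs_le (skFree n (β + δ) - sparseFree n d (β + δ))
  have a2 := neg_abs_le (skFree n (β - δ) - sparseFree n d (β - δ))
  have a3 := le_abs_self (skFree n β - sparseFree n d β)
  have b1 := abs_nonneg (skFree n (β + δ) - sparseFree n d (β + δ))
  have b2 := abs_nonneg (skFree n (β - δ) - sparseFree n d (β - δ))
  rw [le_div_iff₀ hδ, ← abs_of_pos hδ, ← abs_mul, abs_of_pos hδ, abs_le]
  constructor <;> linarith

end Energy

section Limit

lemma eventually_skFree_second_difference_le (β : ℝ) {δ : ℝ} (hδ : 0 < δ) :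
    ∀ᶠ n : ℕ in atTop,
      (skFree n (β + δ) + skFree n (β - δ) - 2 * skFree n β) / n ≤ 3 * δ ^ 2 := by
  obtain ⟨p, hp⟩ := exists_tendsto_skFree β
  obtain ⟨q, hq⟩ := exists_tendsto_skFree (β + δ)
  obtain ⟨r, hr⟩ := exists_tendsto_skFree (β - δ)
  have hdouble : Tendsto (fun n : ℕ => n + n) atTop atTop :=
    tendsto_atTop_mono (fun n => Nat.le_add_left n n) tendsto_id
  have hle : q + r - 5 / 2 * δ ^ 2 ≤ 2 * p := by
    refine le_of_tendsto_of_tendsto ((hq.add hr).sub_const _) ((hp.comp hdouble).const_mul 2) ?_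
    filter_upwards [eventually_gt_atTop 0] with n hn
    have hn0 : (0 : ℝ) < n := Nat.cast_pos.2 hn
    have h := skFree_second_difference n β δ
    simp only [Function.comp_apply, Nat.cast_add]
    have e : 2 * (skFree (n + n) β / ((n : ℝ) + n)) = skFree (n + n) β / n := by
      field_simp
      ring
    rw [e, ← add_div, le_div_iff₀ hn0, sub_mul, div_mul_cancel₀ _ hn0.ne']
    linarith
  have ht : Tendsto (fun n : ℕ => (skFree n (β + δ) + skFree n (β - δ) - 2 * skFree n β) / n) atTop
      (nhds (q + r - 2 * p)) :=
    ((hq.add hr).sub (hp.const_mul 2)).congr fun n => by ring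
  exact ht.eventually_le_const (by nlinarith [sq_pos_of_pos hδ])

lemma eventually_abs_skFree_sub_sparseFree_le {β d η : ℝ} (hβ : 0 ≤ β) (hd : 1 ≤ d) (hη : 0 < η) :
    ∀ᶠ n : ℕ in atTop,
      |skFree n β - sparseFree n d β| / n ≤ 9 * β ^ 3 / Real.sqrt d + η := by
  have h0 : Tendsto (fun n : ℕ => 1 / (2 * (n : ℝ))) atTop (nhds 0) := by
    simpa using (tendsto_inv_atTop_nhds_zero_nat (𝕜 := ℝ)).mul_const (2⁻¹ : ℝ)
  have h1 : Tendsto (fun n : ℕ => 3 * β ^ 3 * (∫ y, |y| ^ 3 ∂gaussianReal 0 1)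
      * Real.sqrt (1 / (2 * n)) + β * Real.sqrt d * (1 / (2 * n))) atTop (nhds 0) := by
    simpa using (h0.sqrt.const_mul (3 * β ^ 3 * (∫ y, |y| ^ 3 ∂gaussianReal 0 1))).add
      (h0.const_mul (β * Real.sqrt d))
  filter_upwards [h1.eventually_le_const hη, eventually_ge_atTop ⌈d⌉₊] with n hn hdn
  have h := abs_skFree_sub_sparseFree_le hβ hd (Nat.ceil_le.1 hdn)
  rw [mul_one_div] at hn
  linarith

lemma eventually_energy_le_of_pos {β d δ : ℝ} (hd : 1 ≤ d) (hδ : 0 < δ) (hδβ : δ ≤ β) :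
    ∀ᶠ n : ℕ in atTop, 1 / (n : ℝ) * |skEnergy n β - sparseEnergy n d β|
      ≤ 6 * δ + 216 * β ^ 3 / (δ * Real.sqrt d) := by
  have hβ : 0 < β := hδ.trans_le hδβ
  have hs : 0 < Real.sqrt d := Real.sqrt_pos.2 (by linarith)
  have hbound : ∀ b, 0 ≤ b → b ≤ 2 * β → ∀ᶠ n : ℕ in atTop,
      |skFree n b - sparseFree n d b| / n ≤ 72 * β ^ 3 / Real.sqrt d + δ ^ 2 := by
    intro b hb hb2
    filter_upwards [eventually_abs_skFree_sub_sparseFree_le hb hd (pow_pos hδ 2)] with n hn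
    refine hn.trans ?_
    have h := pow_le_pow_left₀ hb hb2 3
    have h' : 9 * b ^ 3 ≤ 72 * β ^ 3 := by linarith [mul_pow 2 β 3]
    gcongr ?_ / _ + _
  filter_upwards [eventually_skFree_second_difference_le β hδ, hbound (β + δ) (by linarith)
    (by linarith), hbound (β - δ) (by linarith) (by linarith), hbound β hβ.le (by linarith)]
    with n h1 h2 h3 h4
  have h := abs_skEnergy_sub_sparseEnergy_le n d β hδ
  calc 1 / (n : ℝ) * |skEnergy n β - sparseEnergy n d β|
      ≤ 1 / (n : ℝ) * ((skFree n (β + δ) + skFree n (β - δ) - 2 * skFree n β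
        + |skFree n (β + δ) - sparseFree n d (β + δ)|
        + |skFree n (β - δ) - sparseFree n d (β - δ)|
        + |skFree n β - sparseFree n d β|) / δ) := by gcongr
    _ = ((skFree n (β + δ) + skFree n (β - δ) - 2 * skFree n β) / n
        + |skFree n (β + δ) - sparseFree n d (β + δ)| / n
        + |skFree n (β - δ) - sparseFree n d (β - δ)| / n
        + |skFree n β - sparseFree n d β| / n) / δ := by ring
    _ ≤ (3 * δ ^ 2 + (72 * β ^ 3 / Real.sqrt d + δ ^ 2) + (72 * β ^ 3 / Real.sqrt d + δ ^ 2)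
        + (72 * β ^ 3 / Real.sqrt d + δ ^ 2)) / δ := by gcongr
    _ = 6 * δ + 216 * β ^ 3 / (δ * Real.sqrt d) := by
        field_simp
        ring

lemma boltz_zero {n : ℕ} (X : Fin n → Fin n → ℝ) : boltz 0 X = 0 := by
  funext σ
  simp [boltz]

lemma skEnergy_zero (n : ℕ) : skEnergy n 0 = 0 := by
  simp_rw [skEnergy, avg1_eq_sum_softmax, boltz_zero]
  have hi : ∀ σ : Fin n → Bool, Integrable (fun g => Ham g σ) (skMeasure n) := fun σ =>
    integrable_finsetSum _ fun i _ => integrable_finsetSum _ fun j _ =>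
      ((integrable_entry_skMeasure i j).mul_const _).mul_const _
  rw [integral_finsetSum _ fun σ _ => (hi σ).const_mul _]
  simp_rw [integral_const_mul, integral_Ham_skMeasure, mul_zero, Finset.sum_const_zero]

lemma sum_softmax_zero_mul_magnetization_sq (n : ℕ) :
    ∑ σ : Fin n → Bool, softmax 0 σ * (∑ i, spin (σ i)) ^ 2 = n := by
  have h := integral_magnetization_sq (n := n) 0
  simpa [boltz_zero] using h

lemma sparseEnergy_zero {n : ℕ} (hn : 0 < n) {d : ℝ} (hd : 0 ≤ d) :
    sparseEnergy n d 0 = Real.sqrt d / 2 := by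
  have hn0 : (n : ℝ) ≠ 0 := Nat.cast_ne_zero.2 hn.ne'
  have hi : ∀ (σ : Fin n → Bool) (i j : Fin n), Integrable (fun A : Fin n → Fin n → ℕ =>
      natMat A i j * spin (σ i) * spin (σ j)) (sparseMeasure n d) := fun σ i j =>
    ((integrable_entry_sparseMeasure d i j).mul_const _).mul_const _
  have hH : ∀ σ : Fin n → Bool, ∫ A, Ham (natMat A) σ ∂sparseMeasure n d
      = d / (2 * n) * (∑ i, spin (σ i)) ^ 2 := by
    intro σ
    simp only [Ham]
    rw [integral_finsetSum _ fun i _ => integrable_finsetSum _ fun j _ => hi σ i j]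
    simp_rw [integral_finsetSum _ fun j _ => hi σ _ j, integral_mul_const,
      integral_entry_sparseMeasure hd]
    rw [sq, Finset.sum_mul_sum, Finset.mul_sum]
    refine Finset.sum_congr rfl fun i _ => ?_
    rw [Finset.mul_sum]
    exact Finset.sum_congr rfl fun j _ => by ring
  have hE : ∫ A, avg1 0 (natMat A) (Ham (natMat A)) ∂sparseMeasure n d = d / 2 := by
    simp_rw [avg1_eq_sum_softmax, boltz_zero]
    have hHi : ∀ σ : Fin n → Bool, Integrable (fun A => Ham (natMat A) σ) (sparseMeasure n d) :=
      fun σ => integrable_finsetSum _ fun i _ => integrable_finsetSum _ fun j _ => hi σ i j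
    rw [integral_finsetSum _ fun σ _ => (hHi σ).const_mul _]
    simp_rw [integral_const_mul, hH, mul_left_comm (softmax _ _)]
    rw [← Finset.mul_sum, sum_softmax_zero_mul_magnetization_sq]
    field_simp
  rw [sparseEnergy, zero_div, hE]
  rcases hd.eq_or_lt with rfl | hd
  · simp
  · have hs : 0 < Real.sqrt d := Real.sqrt_pos.2 hd
    field_simp
    exact (Real.sq_sqrt hd.le).symm

lemma eventually_energy_le_zero {d ε : ℝ} (hd : 0 ≤ d) (hε : 0 < ε) :
    ∀ᶠ n : ℕ in atTop, 1 / (n : ℝ) * |skEnergy n 0 - sparseEnergy n d 0| ≤ ε := by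
  have h : Tendsto (fun n : ℕ => 1 / (n : ℝ) * (Real.sqrt d / 2)) atTop (nhds 0) := by
    simpa using (tendsto_inv_atTop_nhds_zero_nat (𝕜 := ℝ)).mul_const (Real.sqrt d / 2)
  filter_upwards [h.eventually_le_const hε, eventually_gt_atTop 0] with n hn hn0
  rw [skEnergy_zero, sparseEnergy_zero hn0 hd, zero_sub, abs_neg, abs_of_nonneg (by positivity)]
  exact hn

lemma eventually_eventually_energy_le {β ε : ℝ} (hβ : 0 ≤ β) (hε : 0 < ε) :
    ∀ᶠ d : ℝ in atTop, ∀ᶠ n : ℕ in atTop,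
      1 / (n : ℝ) * |skEnergy n β - sparseEnergy n d β| ≤ ε := by
  rcases hβ.eq_or_lt with rfl | hβ
  · filter_upwards [eventually_ge_atTop 0] with d hd
    exact eventually_energy_le_zero hd hε
  · set δ := min β (ε / 12) with hδ
    have hδ0 : 0 < δ := lt_min hβ (by positivity)
    have hδε : δ ≤ ε / 12 := min_le_right _ _
    have ht : Tendsto (fun d : ℝ => 216 * β ^ 3 / (δ * Real.sqrt d)) atTop (nhds 0) :=
      tendsto_const_nhds.div_atTop (Real.tendsto_sqrt_atTop.const_mul_atTop hδ0)
    filter_upwards [ht.eventually_le_const (half_pos hε), eventually_ge_atTop 1] with d h hd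
    filter_upwards [eventually_energy_le_of_pos hd hδ0 (min_le_left _ _)] with n hn
    linarith

end Limit

/-- average-energy correspondence between the SK model and the
sparse model in the large-degree limit. -/
theorem stmt_2 (β : ℝ) (hβ : 0 ≤ β) :
    Tendsto (fun d : ℝ =>
      limsup (fun n : ℕ =>
        (1 / (n : ℝ)) *
          |(∫ g, avg1 β g (Ham g) ∂(skMeasure n)) -
            (1 / Real.sqrt d) *
              ∫ A, avg1 (β / Real.sqrt d) (natMat A) (Ham (natMat A)) ∂(sparseMeasure n d)|)
        atTop)
      atTop (nhds 0) := by
  refine Metric.tendsto_nhds.2 fun ε hε => ?_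
  filter_upwards [eventually_eventually_energy_le hβ (half_pos hε)] with d hd
  have hnonneg : ∀ n : ℕ, 0 ≤ 1 / (n : ℝ) * |skEnergy n β - sparseEnergy n d β| :=
    fun n => by positivity
  have hupper : limsup (fun n : ℕ => 1 / (n : ℝ) * |skEnergy n β - sparseEnergy n d β|) atTop
      ≤ ε / 2 :=
    limsup_le_of_le (isCoboundedUnder_le_of_le atTop hnonneg) hd
  have hlower : 0 ≤ limsup (fun n : ℕ => 1 / (n : ℝ) * |skEnergy n β - sparseEnergy n d β|)
      atTop :=
    le_limsup_of_frequently_le (Frequently.of_forall hnonneg) ⟨ε / 2, hd⟩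
  change dist (limsup (fun n : ℕ => 1 / (n : ℝ) * |skEnergy n β - sparseEnergy n d β|) atTop) 0 < ε
  rw [Real.dist_eq, sub_zero, abs_of_nonneg hlower]
  linarith
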